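/- For distinct a,b, the subspace 𝒮_{ab} of A(𝓗^+) spanned by all S_{ab}(m,n) + O(𝓗^+), m,n ∈ ℤ₊, is exactly 5-dimensional, with basis {S_{ab}(1,m) + O(𝓗^+) : 1 ≤ m ≤ 5}. -/

import Mathlib

/-!
Common framework: vertex operator algebras over ℂ encoded via their modes,
weak/admissible/ordinary modules, twisted modules, Zhu's algebra data,
and the free bosonic (Heisenberg) vertex operator algebra `𝓗 = M(1)` of rank `ℓ`
together with its `θ`-fixed subalgebra `𝓗⁺`.
-/

open scoped BigOperators DirectSum TensorProduct

noncomputable section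

/-- Generalized binomial coefficient `(q choose n)` for `q : ℚ`. -/
def qchoose (q : ℚ) : ℕ → ℚ
  | 0 => 1
  | n + 1 => qchoose q n * (q - n) / (n + 1)

/-- Generalized binomial coefficient of an integer, as a complex number. -/
def zchoose (m : ℤ) (n : ℕ) : ℂ := ((qchoose (m : ℚ) n : ℚ) : ℂ)

/-- A vertex operator algebra over `ℂ`, encoded through its modes:
`Y u n : Module.End ℂ V` is the `n`-th mode `u_n` of the vertex operator `Y(u,z)`.
The axioms are: truncation, the vacuum and creation axioms, the (component form of
the) Jacobi/Borcherds identity, a lower-truncated `ℤ`-grading by `L(0)`-eigenvalues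
with finite dimensional homogeneous pieces compatible with the modes, the Virasoro
relations for the conformal vector and the `L(-1)`-derivative (translation) axiom. -/
structure VOA (V : Type) [AddCommGroup V] [Module ℂ V] : Type where
  Y : V →ₗ[ℂ] ℤ → Module.End ℂ V
  one : V
  omega : V
  wt : ℤ → Submodule ℂ V
  centralCharge : ℂ
  internal : DirectSum.IsInternal wt
  one_wt : one ∈ wt 0
  omega_wt : omega ∈ wt 2
  one_ne_zero : one ≠ 0
  fdim : ∀ n : ℤ, FiniteDimensional ℂ (wt n)
  bounded_below : ∃ N : ℤ, ∀ n : ℤ, n < N → wt n = ⊥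
  trunc : ∀ u v : V, ∃ N : ℤ, ∀ n : ℤ, N ≤ n → Y u n v = 0
  vacuum_act : ∀ n : ℤ, Y one n = if n = -1 then (1 : Module.End ℂ V) else 0
  create : ∀ u : V, Y u (-1) one = u
  create_ge : ∀ (u : V) (n : ℤ), 0 ≤ n → Y u n one = 0
  mode_wt : ∀ (k : ℤ) (u : V), u ∈ wt k → ∀ (m n : ℤ) (v : V), v ∈ wt m →
    Y u n v ∈ wt (m + k - n - 1)
  L0_diag : ∀ (n : ℤ) (v : V), v ∈ wt n → Y omega 1 v = (n : ℂ) • v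
  translation : ∀ (u : V) (n : ℤ), Y (Y omega 0 u) n = (-(n : ℂ)) • Y u (n - 1)
  virasoro : ∀ m n : ℤ,
    Y omega (m + 1) * Y omega (n + 1) - Y omega (n + 1) * Y omega (m + 1)
      = ((m : ℂ) - (n : ℂ)) • Y omega (m + n + 1)
        + (if m + n = 0 then (((m ^ 3 - m : ℤ) : ℂ) / 12) * centralCharge else 0)
            • (1 : Module.End ℂ V)
  borcherds : ∀ (u v w : V) (p m n : ℤ),
    ∑ᶠ i : ℕ, zchoose m i • Y (Y u (p + i) v) (m + n - i) w
      = ∑ᶠ i : ℕ, ((-1 : ℂ) ^ i * zchoose p i) •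
          (Y u (m + p - i) (Y v (n + i) w)
            - ((-1 : ℂ) ^ p) • Y v (n + p - i) (Y u (m + i) w))

variable {V : Type} [AddCommGroup V] [Module ℂ V]

/-- Simplicity of a vertex operator algebra: the only subspaces invariant under
all modes are `0` and the whole space. -/
def VOA.Simple (A : VOA V) : Prop :=
  ∀ U : Submodule ℂ V, (∀ (u : V) (n : ℤ) (v : V), v ∈ U → A.Y u n v ∈ U) → U = ⊥ ∨ U = ⊤

/-- The decomposition of a vertex operator algebra into its homogeneous pieces. -/
noncomputable def VOA.decompose (A : VOA V) : V ≃ₗ[ℂ] ⨁ n : ℤ, A.wt n :=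
  (LinearEquiv.ofBijective (DirectSum.coeLinearMap A.wt) A.internal).symm

/-- The homogeneous component of weight `n` of a vector. -/
noncomputable def VOA.hcomp (A : VOA V) (n : ℤ) (u : V) : V := (A.decompose u n : V)

/-- Zhu's product `u * v` for `u` (treated as) homogeneous of weight `k`:
`u*v = ∑_{i≥0} (k choose i) u_{i-1} v`. -/
noncomputable def VOA.mulAux (A : VOA V) (k : ℤ) (u v : V) : V :=
  ∑ᶠ i : ℕ, zchoose k i • A.Y u ((i : ℤ) - 1) v

/-- Zhu's circle product `u ∘ v` for `u` (treated as) homogeneous of weight `k`: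
`u∘v = ∑_{i≥0} (k choose i) u_{i-2} v`. -/
noncomputable def VOA.circAux (A : VOA V) (k : ℤ) (u v : V) : V :=
  ∑ᶠ i : ℕ, zchoose k i • A.Y u ((i : ℤ) - 2) v

/-- Zhu's product `u * v`, extended bilinearly via homogeneous components of `u`. -/
noncomputable def VOA.star (A : VOA V) (u v : V) : V :=
  ∑ᶠ k : ℤ, A.mulAux k (A.hcomp k u) v

/-- The subspace `O(V)` spanned by all circle products `u ∘ v` with `u` homogeneous;
Zhu's algebra is `A(V) = V/O(V)` with product induced by `VOA.star`. -/
def VOA.Osub (A : VOA V) : Submodule ℂ V :=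
  Submodule.span ℂ {w | ∃ (k : ℤ) (u v : V), u ∈ A.wt k ∧ w = A.circAux k u v}

/-- A weak module for a vertex operator algebra, given by modes satisfying
truncation, the vacuum axiom and the Borcherds identity. -/
structure WkMod (A : VOA V) (M : Type) [AddCommGroup M] [Module ℂ M] : Type where
  act : V →ₗ[ℂ] ℤ → Module.End ℂ M
  trunc : ∀ (u : V) (w : M), ∃ N : ℤ, ∀ n : ℤ, N ≤ n → act u n w = 0
  vacuum_act : ∀ n : ℤ, act A.one n = if n = -1 then (1 : Module.End ℂ M) else 0
  borcherds : ∀ (u v : V) (w : M) (p m n : ℤ),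
    ∑ᶠ i : ℕ, zchoose m i • act (A.Y u (p + i) v) (m + n - i) w
      = ∑ᶠ i : ℕ, ((-1 : ℂ) ^ i * zchoose p i) •
          (act u (m + p - i) (act v (n + i) w)
            - ((-1 : ℂ) ^ p) • act v (n + p - i) (act u (m + i) w))

/-- An admissible (`ℕ`-gradable) module for a vertex operator algebra:
a weak module with an `ℕ`-grading with nonzero top level, compatible with weights. -/
structure AdmMod (A : VOA V) (M : Type) [AddCommGroup M] [Module ℂ M]
    extends WkMod A M : Type where
  gr : ℕ → Submodule ℂ M
  grInternal : DirectSum.IsInternal gr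
  top_ne_bot : gr 0 ≠ ⊥
  gr_mode : ∀ (k : ℤ) (u : V), u ∈ A.wt k → ∀ (m : ℤ) (n : ℕ) (w : M), w ∈ gr n →
    act u m w ∈
      if 0 ≤ (n : ℤ) + k - m - 1 then gr ((n : ℤ) + k - m - 1).toNat else ⊥

/-- An ordinary module for a vertex operator algebra: a weak module on which `L(0)`
acts semisimply with finite dimensional eigenspaces whose weights are truncated from
below in each coset `λ + ℤ`. -/
structure OrdMod (A : VOA V) (M : Type) [AddCommGroup M] [Module ℂ M]
    extends WkMod A M : Type where
  wtm : ℂ → Submodule ℂ M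
  indep : iSupIndep wtm
  spans : ⨆ c : ℂ, wtm c = ⊤
  L0_diag : ∀ (c : ℂ) (w : M), w ∈ wtm c → act A.omega 1 w = c • w
  fdim : ∀ c : ℂ, FiniteDimensional ℂ (wtm c)
  bounded_below : ∀ c : ℂ, ∃ N : ℤ, ∀ m : ℤ, m < N → wtm (c + m) = ⊥

/-- Irreducibility of a weak module. -/
def WkMod.Irreducible {A : VOA V} {M : Type} [AddCommGroup M] [Module ℂ M]
    (P : WkMod A M) : Prop :=
  (∃ w : M, w ≠ 0) ∧
    ∀ U : Submodule ℂ M, (∀ (u : V) (n : ℤ) (w : M), w ∈ U → P.act u n w ∈ U) →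
      U = ⊥ ∨ U = ⊤

/-- Isomorphism of two weak modules over the same vertex operator algebra. -/
def ModIso (A : VOA V) {M N : Type} [AddCommGroup M] [Module ℂ M]
    [AddCommGroup N] [Module ℂ N] (P : WkMod A M) (Q : WkMod A N) : Prop :=
  ∃ f : M ≃ₗ[ℂ] N, ∀ (u : V) (n : ℤ) (w : M), f (P.act u n w) = Q.act u n (f w)

/-- The action of the zero-mode `o(u) = u_{wt u - 1}` (extended linearly from
homogeneous vectors) on a weak module; it preserves the top level of an
admissible module. -/
noncomputable def WkMod.oAct {A : VOA V} {M : Type} [AddCommGroup M] [Module ℂ M]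
    (Q : WkMod A M) (u : V) (w : M) : M :=
  ∑ᶠ k : ℤ, Q.act (A.hcomp k u) (k - 1) w

/-- Action of a word of creation operators `h_{a_1}(-n_1) ⋯ h_{a_k}(-n_k)`. -/
def wordAct {ℓ : ℕ} {M : Type} (f : Fin ℓ → ℤ → M → M) : List (Fin ℓ × ℕ+) → M → M
  | [], w => w
  | (a, n) :: L, w => f a (-((n : ℕ) : ℤ)) (wordAct f L w)

/-- Action of a word of twisted creation operators
`h_{a_1}(-n_1+1/2) ⋯ h_{a_k}(-n_k+1/2)` (indices doubled). -/
def twWordAct {ℓ : ℕ} {M : Type} (f : Fin ℓ → ℤ → M → M) : List (Fin ℓ × ℕ+) → M → M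
  | [], w => w
  | (a, n) :: L, w => f a (-(2 * ((n : ℕ) : ℤ) - 1)) (twWordAct f L w)

/-- `A` is the rank `ℓ` free bosonic (Heisenberg) vertex operator algebra
`𝓗 = M(1)`, with generators `hgen a = h_a(-1)𝟏` for an orthonormal basis
`h_1, …, h_ℓ` of `𝔥`: the generators have weight one, their modes satisfy the
Heisenberg commutation relations `[h_a(m), h_b(n)] = m δ_{ab} δ_{m+n,0}`, the
conformal vector is `ω = (1/2) ∑_a h_a(-1)²𝟏`, and `V` is spanned by the vectors
`h_{a_1}(-n_1) ⋯ h_{a_k}(-n_k)𝟏`. -/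
structure IsHeisenberg {ℓ : ℕ} (A : VOA V) (hgen : Fin ℓ → V) : Prop where
  wt_one : ∀ a, hgen a ∈ A.wt 1
  heis_comm : ∀ (a b : Fin ℓ) (m n : ℤ),
    A.Y (hgen a) m * A.Y (hgen b) n - A.Y (hgen b) n * A.Y (hgen a) m
      = (if a = b ∧ m + n = 0 then (m : ℂ) else 0) • (1 : Module.End ℂ V)
  omega_eq : A.omega
      = (1 / 2 : ℂ) • ∑ a : Fin ℓ, A.Y (hgen a) (-1) (A.Y (hgen a) (-1) A.one)
  span_words : Submodule.span ℂ
      {v : V | ∃ L : List (Fin ℓ × ℕ+),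
        v = wordAct (fun a k w => A.Y (hgen a) k w) L A.one} = ⊤

/-- `θ` is the automorphism of the free bosonic vertex operator algebra induced
by `-1` on `𝔥`. -/
structure IsThetaAut {ℓ : ℕ} (A : VOA V) (hgen : Fin ℓ → V) (θ : V ≃ₗ[ℂ] V) : Prop where
  map_one : θ A.one = A.one
  map_omega : θ A.omega = A.omega
  map_Y : ∀ (u : V) (n : ℤ) (v : V), θ (A.Y u n v) = A.Y (θ u) n (θ v)
  map_gen : ∀ a, θ (hgen a) = -hgen a
  map_wt : ∀ (k : ℤ) (v : V), v ∈ A.wt k → θ v ∈ A.wt k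

/-- `B` (with underlying space `W`, embedded in `V` by `ι`) is the fixed point
vertex operator subalgebra `V^θ` of the involution `θ`. -/
structure IsFixedSubVOA {W : Type} [AddCommGroup W] [Module ℂ W]
    (A : VOA V) (θ : V ≃ₗ[ℂ] V) (B : VOA W) (ι : W →ₗ[ℂ] V) : Prop where
  inj : Function.Injective ι
  range_eq : LinearMap.range ι
      = Module.End.eigenspace (θ.toLinearMap : Module.End ℂ V) 1
  map_one : ι B.one = A.one
  map_omega : ι B.omega = A.omega
  map_Y : ∀ (u : W) (n : ℤ) (v : W), ι (B.Y u n v) = A.Y (ι u) n (ι v)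
  map_wt : ∀ (k : ℤ) (w : W), w ∈ B.wt k ↔ ι w ∈ A.wt k

/-- `P` is (isomorphic to) the Fock module `M(1,λ)` over the rank `ℓ` Heisenberg
vertex operator algebra: it has a nonzero vector `v₀` with `h_a(n)v₀ = 0` for
`n ≥ 1`, `h_a(0)v₀ = λ_a v₀`, which generates `M` under the creation operators. -/
def IsFockModule {ℓ : ℕ} {M : Type} [AddCommGroup M] [Module ℂ M]
    (A : VOA V) (hgen : Fin ℓ → V) (P : WkMod A M) (lam : Fin ℓ → ℂ) : Prop :=
  ∃ v0 : M, v0 ≠ 0 ∧ (∀ (a : Fin ℓ) (n : ℤ), 1 ≤ n → P.act (hgen a) n v0 = 0) ∧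
    (∀ a : Fin ℓ, P.act (hgen a) 0 v0 = lam a • v0) ∧
    Submodule.span ℂ {w : M | ∃ L : List (Fin ℓ × ℕ+),
      w = wordAct (fun a k x => P.act (hgen a) k x) L v0} = ⊤

/-- A weak `θ`-twisted module (for an involution `θ`): the modes are indexed by
`(1/2)ℤ`, encoded here by doubling (so `act u k` is the mode `u_{k/2}`); on the
eigenspace `θ = (-1)^r` only modes with `k ≡ r (mod 2)` act, and the component
form of the twisted Jacobi identity holds. -/
structure TwMod (A : VOA V) (θ : V ≃ₗ[ℂ] V) (M : Type) [AddCommGroup M]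
    [Module ℂ M] : Type where
  act : V →ₗ[ℂ] ℤ → Module.End ℂ M
  trunc : ∀ (u : V) (w : M), ∃ N : ℤ, ∀ n : ℤ, N ≤ n → act u n w = 0
  vacuum_act : ∀ n : ℤ, act A.one n = if n = -2 then (1 : Module.End ℂ M) else 0
  moding : ∀ (u : V) (r : ℤ), θ u = ((-1 : ℂ) ^ r) • u →
    ∀ k : ℤ, (k - r) % 2 ≠ 0 → act u k = 0
  borcherds : ∀ (u v : V) (r s : ℤ), θ u = ((-1 : ℂ) ^ r) • u →
    θ v = ((-1 : ℂ) ^ s) • v → ∀ (w : M) (p K N : ℤ),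
    ∑ᶠ i : ℕ, ((qchoose ((K : ℚ) / 2) i : ℚ) : ℂ) • act (A.Y u (p + i) v) (K + N - 2 * i) w
      = ∑ᶠ i : ℕ, ((-1 : ℂ) ^ i * zchoose p i) •
          (act u (K + 2 * p - 2 * i) (act v (N + 2 * i) w)
            - ((-1 : ℂ) ^ p) • act v (N + 2 * p - 2 * i) (act u (K + 2 * i) w))

/-- Irreducibility of a twisted module. -/
def TwMod.Irreducible {A : VOA V} {θ : V ≃ₗ[ℂ] V} {M : Type} [AddCommGroup M]
    [Module ℂ M] (T : TwMod A θ M) : Prop :=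
  (∃ w : M, w ≠ 0) ∧
    ∀ U : Submodule ℂ M, (∀ (u : V) (k : ℤ) (w : M), w ∈ U → T.act u k w ∈ U) →
      U = ⊥ ∨ U = ⊤

/-- `T` is (isomorphic to) the canonical irreducible `θ`-twisted module
`𝓗(θ) = S(𝔥 ⊗ t^{-1/2}ℂ[t^{-1/2}])` of the rank `ℓ` free bosonic vertex operator
algebra: it has a nonzero vector killed by all modes `h_a(k/2)`, `k ≥ 1`, which
generates it under the twisted creation operators. -/
def IsCanonicalTwMod {ℓ : ℕ} {M : Type} [AddCommGroup M] [Module ℂ M]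
    (A : VOA V) (hgen : Fin ℓ → V) {θ : V ≃ₗ[ℂ] V} (T : TwMod A θ M) : Prop :=
  ∃ v0 : M, v0 ≠ 0 ∧ (∀ (a : Fin ℓ) (k : ℤ), 1 ≤ k → T.act (hgen a) k v0 = 0) ∧
    Submodule.span ℂ {w : M | ∃ L : List (Fin ℓ × ℕ+),
      w = twWordAct (fun a k x => T.act (hgen a) k x) L v0} = ⊤

/-- `σ` is the canonical involution of the twisted module `𝓗(θ)` (acting by
`(-1)^k` on monomials of length `k`): it is an involution compatible with `θ`
through the twisted action and fixing the lowest weight vectors. -/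
def TwInvolution {ℓ : ℕ} {M : Type} [AddCommGroup M] [Module ℂ M]
    (A : VOA V) (hgen : Fin ℓ → V) {θ : V ≃ₗ[ℂ] V} (T : TwMod A θ M)
    (σ : M ≃ₗ[ℂ] M) : Prop :=
  (∀ w : M, σ (σ w) = w) ∧
  (∀ (u : V) (k : ℤ) (w : M), σ (T.act u k w) = T.act (θ u) k (σ w)) ∧
  (∀ v0 : M, (∀ (a : Fin ℓ) (k : ℤ), 1 ≤ k → T.act (hgen a) k v0 = 0) → σ v0 = v0)

/-- The weak `B = V^θ`-module `Q` "is" the eigenspace `V^{(ε)}` of `θ` on `V`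
(e.g. `𝓗⁺` itself for `ε = 1` and `𝓗⁻` for `ε = -1`), with action obtained by
restricting the vertex operators of `V`. -/
def IsEigenPartModule {W N : Type} [AddCommGroup W] [Module ℂ W]
    [AddCommGroup N] [Module ℂ N] (A : VOA V) (θ : V ≃ₗ[ℂ] V) {B : VOA W}
    (ι : W →ₗ[ℂ] V) (ε : ℂ) (Q : WkMod B N) : Prop :=
  ∃ j : N →ₗ[ℂ] V, Function.Injective j ∧
    LinearMap.range j = Module.End.eigenspace (θ.toLinearMap : Module.End ℂ V) ε ∧
    ∀ (u : W) (n : ℤ) (w : N), j (Q.act u n w) = A.Y (ι u) n (j w)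

/-- The weak `B = V^θ`-module `Q` "is" the eigenspace `𝓗(θ)^{(ε)}` of the
involution `σ` on the twisted module `𝓗(θ)`, with the restricted twisted action
(`u ∈ V^θ` acts by its integral modes). -/
def IsTwEigenPartModule {W MT N : Type} [AddCommGroup W] [Module ℂ W]
    [AddCommGroup MT] [Module ℂ MT] [AddCommGroup N] [Module ℂ N]
    (A : VOA V) {θ : V ≃ₗ[ℂ] V} {B : VOA W} (ι : W →ₗ[ℂ] V)
    (T : TwMod A θ MT) (σ : MT ≃ₗ[ℂ] MT) (ε : ℂ) (Q : WkMod B N) : Prop :=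
  ∃ j : N →ₗ[ℂ] MT, Function.Injective j ∧
    LinearMap.range j = Module.End.eigenspace (σ.toLinearMap : Module.End ℂ MT) ε ∧
    ∀ (u : W) (n : ℤ) (w : N), j (Q.act u n w) = T.act (ι u) (2 * n) (j w)

/-- The weak `B = 𝓗⁺`-module `Q` "is" the restriction to `𝓗⁺` of the Fock module
`M(1,λ)`. -/
def IsFockRestriction {ℓ : ℕ} {W N : Type} [AddCommGroup W] [Module ℂ W]
    [AddCommGroup N] [Module ℂ N] (A : VOA V) (hgen : Fin ℓ → V) {B : VOA W}
    (ι : W →ₗ[ℂ] V) (lam : Fin ℓ → ℂ) (Q : WkMod B N) : Prop :=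
  ∃ P : WkMod A N, IsFockModule A hgen P lam ∧
    ∀ (u : W) (n : ℤ), Q.act u n = P.act (ι u) n

/-- A realization of Zhu's algebra `A(V) = V/O(V)` of a vertex operator algebra
as an abstract associative `ℂ`-algebra `R`. -/
structure ZhuRealization (A : VOA V) (R : Type) [Ring R] [Algebra ℂ R] : Type where
  π : V →ₗ[ℂ] R
  surj : Function.Surjective π
  ker_eq : LinearMap.ker π = A.Osub
  map_star : ∀ u v : V, π (A.star u v) = π u * π v
  map_one : π A.one = 1

/-- The `R = A(V)`-module `M` "is" the top level `N(0)` of the admissible module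
`N`, where `[u] ∈ A(V)` acts on the top level by the zero-mode `o(u)`. -/
def IsTopLevelOf {R : Type} [Ring R] [Algebra ℂ R] {A : VOA V}
    (Z : ZhuRealization A R) {N : Type} [AddCommGroup N] [Module ℂ N]
    (Qa : AdmMod A N) (M : Type) [AddCommGroup M] [Module R M] : Prop :=
  ∃ f : M →+ N, Function.Injective f ∧ (∀ m : M, f m ∈ Qa.gr 0) ∧
    (∀ w ∈ Qa.gr 0, ∃ m : M, f m = w) ∧
    ∀ (u : V) (m : M), f (Z.π u • m) = Qa.toWkMod.oAct u (f m)

/-- Iterated Zhu product of a list of elements (an empty product is `[𝟏]`). -/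
noncomputable def starList (A : VOA V) : List V → V
  | [] => A.one
  | x :: L => A.star x (starList A L)

/-- The linear span of all Zhu-monomials in a set of generators; modulo `O(V)`
this is the subalgebra of `A(V)` generated by the images of the generators. -/
def genMonomials (A : VOA V) (gens : Set V) : Submodule ℂ V :=
  Submodule.span ℂ {w : V | ∃ L : List V, (∀ g ∈ L, g ∈ gens) ∧ w = starList A L}

/-- The subspace `𝓦^α ⊆ 𝓗` spanned by the monomials
`h_{a_1}(-n_1) ⋯ h_{a_k}(-n_k)𝟏` whose number of letters from `𝓗_c` is odd
exactly for `c ∈ α`; thus `wordSpanV A hgen ∅ = 𝓦 = 𝓗₁⁺ ⊗ ⋯ ⊗ 𝓗_ℓ⁺`. -/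
def wordSpanV {ℓ : ℕ} (A : VOA V) (hgen : Fin ℓ → V) (α : Finset (Fin ℓ)) :
    Submodule ℂ V :=
  Submodule.span ℂ {v : V | ∃ L : List (Fin ℓ × ℕ+),
    (∀ c : Fin ℓ, c ∈ α ↔ ¬ Even ((L.map Prod.fst).count c)) ∧
    v = wordAct (fun a k w => A.Y (hgen a) k w) L A.one}

/-- The element `S_{ab}(m,n) = h_a(-m)h_b(-n)𝟏` of `𝓗`. -/
def SV {ℓ : ℕ} (A : VOA V) (hgen : Fin ℓ → V) (a b : Fin ℓ) (m n : ℤ) : V :=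
  A.Y (hgen a) (-m) (A.Y (hgen b) (-n) A.one)

/-- The element `ω_a = (1/2) h_a(-1)²𝟏` of `𝓗⁺`. -/
def omegaV {ℓ : ℕ} (A : VOA V) (hgen : Fin ℓ → V) (a : Fin ℓ) : V :=
  (1 / 2 : ℂ) • SV A hgen a a 1 1

/-- The element `J_a = h_a(-1)⁴𝟏 - 2h_a(-3)h_a(-1)𝟏 + (3/2)h_a(-2)²𝟏` of `𝓗⁺`. -/
def JV {ℓ : ℕ} (A : VOA V) (hgen : Fin ℓ → V) (a : Fin ℓ) : V :=
  A.Y (hgen a) (-1) (A.Y (hgen a) (-1) (A.Y (hgen a) (-1) (A.Y (hgen a) (-1) A.one)))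
    - (2 : ℂ) • SV A hgen a a 3 1 + (3 / 2 : ℂ) • SV A hgen a a 2 2

variable {W : Type} [AddCommGroup W] [Module ℂ W]

/-- `E^u_{ab}` (for `a ≠ b`), as a combination of the `S_{ab}(1,m)`. -/
def EuW {ℓ : ℕ} (s : Fin ℓ → Fin ℓ → ℤ → ℤ → W) (a b : Fin ℓ) : W :=
  (5 : ℂ) • s a b 1 2 + (25 : ℂ) • s a b 1 3 + (36 : ℂ) • s a b 1 4 + (16 : ℂ) • s a b 1 5

/-- `E^t_{ab}` (for `a ≠ b`), as a combination of the `S_{ab}(1,m)`. -/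
def EtW {ℓ : ℕ} (s : Fin ℓ → Fin ℓ → ℤ → ℤ → W) (a b : Fin ℓ) : W :=
  (-16 : ℂ) • ((3 : ℂ) • s a b 1 2 + (14 : ℂ) • s a b 1 3 + (19 : ℂ) • s a b 1 4
    + (8 : ℂ) • s a b 1 5)

/-- `Λ_{ab}` (for `a ≠ b`), as a combination of the `S_{ab}(1,m)`. -/
def LamW {ℓ : ℕ} (s : Fin ℓ → Fin ℓ → ℤ → ℤ → W) (a b : Fin ℓ) : W :=
  (45 : ℂ) • s a b 1 2 + (190 : ℂ) • s a b 1 3 + (240 : ℂ) • s a b 1 4 + (96 : ℂ) • s a b 1 5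

/-- The full setting of the paper: `A = 𝓗` is the rank `ℓ` free bosonic vertex
operator algebra with Heisenberg generators `hgen`, `θ` is its `-1` involution,
and `B = 𝓗⁺` is the fixed point vertex operator subalgebra, embedded by `ι`. -/
structure HeisenbergPlusSetting (ℓ : ℕ) (V W : Type) [AddCommGroup V] [Module ℂ V]
    [AddCommGroup W] [Module ℂ W] : Type where
  A : VOA V
  hgen : Fin ℓ → V
  heis : IsHeisenberg A hgen
  θ : V ≃ₗ[ℂ] V
  thetaAut : IsThetaAut A hgen θ
  B : VOA W
  ι : W →ₗ[ℂ] V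
  fixedSub : IsFixedSubVOA A θ B ι

/-- Bundled weak module over a vertex operator algebra. -/
structure ARep (A : VOA V) : Type 1 where
  carrier : Type
  [acg : AddCommGroup carrier]
  [mod : Module ℂ carrier]
  str : WkMod A carrier

attribute [instance] ARep.acg ARep.mod

/-- Bundled admissible module over a vertex operator algebra. -/
structure BRep (A : VOA V) : Type 1 where
  carrier : Type
  [acg : AddCommGroup carrier]
  [mod : Module ℂ carrier]
  adm : AdmMod A carrier

attribute [instance] BRep.acg BRep.mod

/-- Bundled twisted module over a vertex operator algebra with involution. -/
structure TwRep (A : VOA V) (θ : V ≃ₗ[ℂ] V) : Type 1 where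
  carrier : Type
  [acg : AddCommGroup carrier]
  [mod : Module ℂ carrier]
  str : TwMod A θ carrier

attribute [instance] TwRep.acg TwRep.mod

end

theorem zz_choose_rec (x : ℂ) (n : ℕ) :
    ((n : ℂ) + 1) * Ring.choose x (n + 1) = Ring.choose x n * (x - n) := by
  have := Ring.choose_smul_choose x (Nat.le_succ n)
  simpa using this

theorem zz_zchoose (m : ℤ) (n : ℕ) : zchoose m n = Ring.choose (m : ℂ) n := by
  unfold zchoose
  induction n with
  | zero => simp [qchoose]
  | succ n ih =>
    have h := zz_choose_rec (m : ℂ) n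
    have hn : (n : ℂ) + 1 ≠ 0 := by exact_mod_cast Nat.succ_ne_zero n
    rw [← ih] at h
    simp only [qchoose]
    push_cast
    rw [div_eq_iff hn, mul_comm (Ring.choose _ _), h]

theorem zz_choose_neg (n i : ℕ) :
    (-1 : ℂ) ^ i * Ring.choose (-((n : ℂ) + 1)) i = ((n + i).choose i : ℂ) := by
  rw [Ring.choose_neg]
  have : ((n : ℂ) + 1 + i - 1) = ((n + i : ℕ) : ℂ) := by push_cast; ring
  rw [this, Ring.choose_natCast, Units.smul_def, zsmul_eq_mul, ← mul_assoc,
    ← Int.cast_negOnePow_natCast]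
  rw [Int.cast_negOnePow_natCast, ← mul_pow]
  simp

/-- finsum over ℕ as a range sum -/
theorem zz_fsum {M : Type*} [AddCommMonoid M] (f : ℕ → M) (N : ℕ) (h : ∀ i, N ≤ i → f i = 0) :
    ∑ᶠ i, f i = ∑ i ∈ Finset.range N, f i := by
  apply finsum_eq_sum_of_support_subset
  intro i hi
  simp only [Finset.coe_range, Set.mem_Iio]
  by_contra hc
  exact hi (h i (not_lt.mp hc))

theorem zz_sum_ext {M : Type*} [AddCommMonoid M] (f : ℕ → M) (N N' : ℕ)
    (h : ∀ i, N ≤ i → f i = 0) (h' : ∀ i, N' ≤ i → f i = 0) :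
    ∑ i ∈ Finset.range N, f i = ∑ i ∈ Finset.range N', f i := by
  rw [← zz_fsum f N h, ← zz_fsum f N' h']

section
variable {V : Type} [AddCommGroup V] [Module ℂ V] (A : VOA V)

theorem zz_trunc (u v : V) : ∃ N : ℕ, ∀ n : ℤ, (N : ℤ) ≤ n → A.Y u n v = 0 := by
  obtain ⟨N, hN⟩ := A.trunc u v
  exact ⟨N.toNat, fun n hn => hN n (by omega)⟩

/-- Borcherds, finite form: bounds given. -/
theorem zz_borch (u v w : V) (p m n : ℤ) (N : ℕ)
    (h1 : ∀ i : ℤ, N + p ≤ i → A.Y u i v = 0)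
    (h2 : ∀ i : ℤ, N + n ≤ i → A.Y v i w = 0)
    (h3 : ∀ i : ℤ, N + m ≤ i → A.Y u i w = 0) :
    ∑ i ∈ Finset.range N, Ring.choose (m : ℂ) i • A.Y (A.Y u (p + i) v) (m + n - i) w
      = ∑ i ∈ Finset.range N, ((-1 : ℂ) ^ i * Ring.choose (p : ℂ) i) •
          (A.Y u (m + p - i) (A.Y v (n + i) w)
            - ((-1 : ℂ) ^ p) • A.Y v (n + p - i) (A.Y u (m + i) w)) := by
  have := A.borcherds u v w p m n
  rw [zz_fsum _ N, zz_fsum _ N] at this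
  · simpa only [zz_zchoose] using this
  · intro i hi
    rw [h2 _ (by omega), h3 _ (by omega)]; simp
  · intro i hi
    rw [h1 _ (by omega)]; simp

/-- zero mode is a derivation -/
theorem zz_zero (u v w : V) (n : ℤ) :
    A.Y u 0 (A.Y v n w) = A.Y (A.Y u 0 v) n w + A.Y v n (A.Y u 0 w) := by
  obtain ⟨N1, h1⟩ := zz_trunc A u v
  obtain ⟨N2, h2⟩ := zz_trunc A v w
  obtain ⟨N3, h3⟩ := zz_trunc A u w
  have := zz_borch A u v w 0 0 n (N1 + N2 + N3 + n.natAbs + 1) (fun i hi => h1 i (by omega))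
    (fun i hi => h2 i (by omega)) (fun i hi => h3 i (by omega))
  rw [Finset.sum_range_succ', Finset.sum_range_succ'] at this
  simp [Ring.choose_zero_succ] at this
  rw [this]; abel

/-- first mode -/
theorem zz_one (u v w : V) (n : ℤ) :
    A.Y u 1 (A.Y v n w) = A.Y (A.Y u 0 v) (n + 1) w + A.Y (A.Y u 1 v) n w
      + A.Y v n (A.Y u 1 w) := by
  obtain ⟨N1, h1⟩ := zz_trunc A u v
  obtain ⟨N2, h2⟩ := zz_trunc A v w
  obtain ⟨N3, h3⟩ := zz_trunc A u w
  have := zz_borch A u v w 0 1 n (N1 + N2 + N3 + n.natAbs + 1 + 1) (fun i hi => h1 i (by omega))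
    (fun i hi => h2 i (by omega)) (fun i hi => h3 i (by omega))
  rw [Finset.sum_range_succ', Finset.sum_range_succ', Finset.sum_range_succ' (n := _ + 1)] at this
  have e : ∀ k : ℕ, Ring.choose (1 : ℂ) (k + 1 + 1) = 0 := by
    intro k
    have := Ring.choose_natCast (R := ℂ) 1 (k + 1 + 1)
    rw [Nat.cast_one] at this
    rw [this, Nat.choose_eq_zero_of_lt (by omega)]; simp
  simp [Ring.choose_zero_succ, e] at this
  rw [add_comm 1 n] at this
  rw [add_comm (A.Y (A.Y u 0 v) (n + 1) w), this]; abel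

/-- modes of `u_{-1} v` -/
theorem zz_neg_one (u v w : V) (n : ℤ) (N : ℕ)
    (h2 : ∀ i : ℤ, N + n ≤ i → A.Y v i w = 0)
    (h3 : ∀ i : ℤ, N ≤ i → A.Y u i w = 0) :
    A.Y (A.Y u (-1) v) n w = ∑ i ∈ Finset.range N,
      (A.Y u (-1 - i) (A.Y v (n + i) w) + A.Y v (n - 1 - i) (A.Y u i w)) := by
  obtain ⟨N1, h1⟩ := zz_trunc A u v
  have := zz_borch A u v w (-1) 0 n (N + N1 + 1) (fun i hi => h1 i (by omega))
    (fun i hi => h2 i (by omega)) (fun i hi => h3 i (by omega))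
  rw [Finset.sum_range_succ'] at this
  simp [Ring.choose_zero_succ] at this
  rw [this]
  rw [zz_sum_ext _ (N + N1 + 1) N]
  · apply Finset.sum_congr rfl
    intro i _
    have := zz_choose_neg 0 i
    simp at this
    rw [this]
    simp [sub_eq_add_neg]
  · intro i hi
    rw [h2 _ (by omega), h3 _ (by omega)]; simp
  · intro i hi
    rw [h2 _ (by omega), h3 _ (by omega)]; simp

theorem zz_circ (k : ℤ) (u v : V) (N : ℕ) (h : ∀ i : ℤ, N ≤ i + 2 → A.Y u i v = 0) :
    A.circAux k u v = ∑ i ∈ Finset.range N, Ring.choose (k : ℂ) i • A.Y u ((i : ℤ) - 2) v := by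
  unfold VOA.circAux
  rw [zz_fsum _ N]
  · simp only [zz_zchoose]
  · intro i hi
    rw [h _ (by omega)]; simp

theorem zz_D_circ (t u v : V) (k : ℤ) :
    A.Y t 0 (A.circAux k u v) + A.Y t 1 (A.circAux k u v)
      = A.circAux (k + 1) (A.Y t 0 u) v + A.circAux k (A.Y t 1 u) v
        + A.circAux k u (A.Y t 0 v + A.Y t 1 v) := by
  obtain ⟨N1, h1⟩ := zz_trunc A u v
  obtain ⟨N2, h2⟩ := zz_trunc A (A.Y t 0 u) v
  obtain ⟨N3, h3⟩ := zz_trunc A (A.Y t 1 u) v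
  obtain ⟨N4, h4⟩ := zz_trunc A u (A.Y t 0 v + A.Y t 1 v)
  have hN := zz_circ A (k + 1) (A.Y t 0 u) v (N1 + N2 + N3 + N4 + 2 + 1) (fun i hi => h2 i (by omega))
  rw [hN]
  rw [zz_circ A k u v (N1 + N2 + N3 + N4 + 2) (fun i hi => h1 i (by omega)),
    zz_circ A k (A.Y t 1 u) v (N1 + N2 + N3 + N4 + 2) (fun i hi => h3 i (by omega)),
    zz_circ A k u _ (N1 + N2 + N3 + N4 + 2) (fun i hi => h4 i (by omega))]
  have e2 : ∑ i ∈ Finset.range (N1 + N2 + N3 + N4 + 2 + 1),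
        Ring.choose ((k + 1 : ℤ) : ℂ) i • A.Y (A.Y t 0 u) ((i : ℤ) - 2) v
      = ∑ i ∈ Finset.range (N1 + N2 + N3 + N4 + 2), Ring.choose (k : ℂ) i • A.Y (A.Y t 0 u) ((i : ℤ) - 2) v
       + ∑ i ∈ Finset.range (N1 + N2 + N3 + N4 + 2), Ring.choose (k : ℂ) i • A.Y (A.Y t 0 u) ((i : ℤ) - 2 + 1) v := by
    rw [zz_sum_ext (fun i : ℕ => Ring.choose (k : ℂ) i • A.Y (A.Y t 0 u) ((i : ℤ) - 2) v)
      (N1 + N2 + N3 + N4 + 2) (N1 + N2 + N3 + N4 + 2 + 1)]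
    · rw [Finset.sum_range_succ', Finset.sum_range_succ' (fun i : ℕ => Ring.choose (k : ℂ) i • A.Y (A.Y t 0 u) ((i : ℤ) - 2) v)]
      rw [add_right_comm (Finset.sum _ _), ← Finset.sum_add_distrib]
      congr 1
      · apply Finset.sum_congr rfl
        intro i _
        push_cast
        rw [Ring.choose_succ_succ, add_smul, add_comm]
        congr 3
        ring_nf
      · simp
    · intro i hi
      rw [h2 _ (by omega)]; simp
    · intro i hi
      rw [h2 _ (by omega)]; simp
  rw [e2, map_sum, map_sum, ← Finset.sum_add_distrib, ← Finset.sum_add_distrib, ← Finset.sum_add_distrib, ← Finset.sum_add_distrib]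
  apply Finset.sum_congr rfl
  intro i _
  rw [map_smul, map_smul, zz_zero, zz_one]
  simp only [map_add, smul_add]
  abel

end

section
variable {V : Type} [AddCommGroup V] [Module ℂ V] {A : VOA V} {ℓ : ℕ} {hgen : Fin ℓ → V}

theorem zz_comm (hH : IsHeisenberg A hgen) (a b : Fin ℓ) (m n : ℤ) (x : V) :
    A.Y (hgen a) m (A.Y (hgen b) n x) = A.Y (hgen b) n (A.Y (hgen a) m x)
      + (if a = b ∧ m + n = 0 then (m : ℂ) else 0) • x := by
  have := congrArg (fun f : Module.End ℂ V => f x) (hH.heis_comm a b m n)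
  simp only [LinearMap.sub_apply, Module.End.mul_apply, LinearMap.smul_apply,
    Module.End.one_apply] at this
  rw [← this]; abel

theorem zz_word_ind (hH : IsHeisenberg A hgen) (P : V → Prop) (h1 : P A.one)
    (h0 : P 0) (hadd : ∀ x y, P x → P y → P (x + y)) (hsm : ∀ (c : ℂ) x, P x → P (c • x))
    (hw : ∀ (a : Fin ℓ) (n : ℕ) (x : V), 0 < n → P x → P (A.Y (hgen a) (-(n : ℤ)) x)) (v : V) : P v := by
  have hv : v ∈ Submodule.span ℂ {v : V | ∃ L : List (Fin ℓ × ℕ+),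
        v = wordAct (fun a k w => A.Y (hgen a) k w) L A.one} := by
    rw [hH.span_words]; trivial
  induction hv using Submodule.span_induction with
  | mem x hx =>
    obtain ⟨L, rfl⟩ := hx
    induction L with
    | nil => exact h1
    | cons p L ih =>
      obtain ⟨a, n⟩ := p
      exact hw a n _ n.pos ih
  | zero => exact h0
  | add x y _ _ hx hy => exact hadd x y hx hy
  | smul c x _ hx => exact hsm c x hx

theorem zz_H0 (hH : IsHeisenberg A hgen) (c : Fin ℓ) (x : V) : A.Y (hgen c) 0 x = 0 := by
  refine zz_word_ind hH (fun x => A.Y (hgen c) 0 x = 0) ?_ ?_ ?_ ?_ ?_ x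
  · exact A.create_ge _ _ le_rfl
  · simp
  · intro x y hx hy; rw [map_add, hx, hy, add_zero]
  · intro d x hx; rw [map_smul, hx, smul_zero]
  · intro a n x hn hx
    rw [zz_comm hH, hx]; simp

theorem zz_om_one (A : VOA V) : A.Y A.omega 0 A.one = 0 := A.create_ge _ _ le_rfl

theorem zz_om_Y (u v : V) (n : ℤ) :
    A.Y A.omega 0 (A.Y u n v) = (-(n : ℂ)) • A.Y u (n - 1) v + A.Y u n (A.Y A.omega 0 v) := by
  rw [zz_zero, A.translation]; simp

theorem zz_S_wt (hH : IsHeisenberg A hgen) (a b : Fin ℓ) (m n : ℤ) :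
    SV A hgen a b m n ∈ A.wt (m + n) := by
  unfold SV
  have h1 := A.mode_wt 1 _ (hH.wt_one b) 0 (-n) _ A.one_wt
  have h2 := A.mode_wt 1 _ (hH.wt_one a) _ (-m) _ h1
  convert h2 using 2; ring

theorem zz_circ_one (k : ℤ) (u : V) :
    A.circAux k u A.one = A.Y A.omega 0 u + (k : ℂ) • u := by
  have h := zz_circ A k u A.one 2 (fun i hi => A.create_ge _ _ (by omega))
  rw [h, Finset.sum_range_succ, Finset.sum_range_one]
  have : A.Y (A.Y A.omega 0 u) (-1) A.one = A.Y u (-2) A.one := by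
    rw [A.translation]; simp
  rw [A.create] at this
  simp [this, A.create]

theorem zz_T (a b : Fin ℓ) (m n k : ℤ) :
    A.circAux k (SV A hgen a b m n) A.one =
      (m : ℂ) • SV A hgen a b (m + 1) n + (n : ℂ) • SV A hgen a b m (n + 1)
        + (k : ℂ) • SV A hgen a b m n := by
  rw [zz_circ_one]
  unfold SV
  rw [zz_om_Y, zz_om_Y, zz_om_one]
  simp [sub_eq_add_neg, add_comm]

/-- binomial 2 circle product -/
theorem zz_circ2 (u v : V) : A.circAux 2 u v
    = A.Y u (-2) v + (2 : ℂ) • A.Y u (-1) v + A.Y u 0 v := by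
  obtain ⟨N, h⟩ := zz_trunc A u v
  rw [zz_circ A 2 u v (N + 3) (fun i hi => h i (by omega))]
  rw [Finset.sum_range_succ', Finset.sum_range_succ', Finset.sum_range_succ']
  have e : ∀ k : ℕ, Ring.choose (2 : ℂ) k = ((Nat.choose 2 k : ℕ) : ℂ) := by
    intro k
    exact_mod_cast Ring.choose_natCast (R := ℂ) 2 k
  rw [Finset.sum_eq_zero]
  · simp [e]; abel
  · intro i _
    have := e (i + 1 + 1 + 1)
    rw [Nat.choose_eq_zero_of_lt (by omega)] at this
    push_cast
    rw [this]; simp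

theorem zz_Hkill (c : Fin ℓ) (k : ℤ) (hk : 0 ≤ k) : A.Y (hgen c) k A.one = 0 := A.create_ge _ _ hk

theorem zz_commP (hH : IsHeisenberg A hgen) (a b : Fin ℓ) (m n : ℤ) (x : V) (hm : 0 ≤ m) (hn : n < 0) :
    A.Y (hgen a) m (A.Y (hgen b) n x) = A.Y (hgen b) n (A.Y (hgen a) m x)
      + (if a = b ∧ m + n = 0 then (m : ℂ) else 0) • x := zz_comm hH a b m n x

theorem zz_commN (hH : IsHeisenberg A hgen) (a b : Fin ℓ) (m n : ℤ) (x : V) (hm : m < 0) (hn : n < 0) :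
    A.Y (hgen a) m (A.Y (hgen b) n x) = A.Y (hgen b) n (A.Y (hgen a) m x) := by
  rw [zz_comm hH, if_neg (by omega)]; simp

/-- modes of quadratic vectors -/
theorem zz_quad (c d : Fin ℓ) (n : ℤ) (w : V) (N : ℕ)
    (h2 : ∀ i : ℤ, N + n ≤ i → A.Y (hgen d) i w = 0)
    (h3 : ∀ i : ℤ, N ≤ i → A.Y (hgen c) i w = 0) :
    A.Y (SV A hgen c d 1 1) n w = ∑ i ∈ Finset.range N,
      (A.Y (hgen c) (-1 - i) (A.Y (hgen d) (n + i) w) + A.Y (hgen d) (n - 1 - i) (A.Y (hgen c) i w)) := by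
  unfold SV
  rw [A.create, zz_neg_one A _ _ w n N h2 h3]

theorem zz_bd2 (hH : IsHeisenberg A hgen) (c d e : Fin ℓ) (p q : ℤ) (i : ℤ) (hi : 0 < i) (hp : p < i) (hq : q < i)  :
    A.Y (hgen c) i (A.Y (hgen d) (-p) (A.Y (hgen e) (-q) A.one)) = 0 := by
  rw [zz_comm hH, zz_comm hH c e, zz_Hkill _ _ (by omega), if_neg (by omega), if_neg (by omega)]; simp

/-- the derivation `2 D_b` -/
def zz_D (A : VOA V) (hgen : Fin ℓ → V) (b : Fin ℓ) : V →ₗ[ℂ] V :=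
  A.Y (SV A hgen b b 1 1) 0 + A.Y (SV A hgen b b 1 1) 1

theorem zz_D_apply (b : Fin ℓ) (x : V) : zz_D A hgen b x =
  A.Y (SV A hgen b b 1 1) 0 x + A.Y (SV A hgen b b 1 1) 1 x := rfl

theorem zz_gen (c : Fin ℓ) : hgen c = A.Y (hgen c) (-1) A.one := (A.create _).symm

theorem zz_bd1 (hH : IsHeisenberg A hgen) (c d : Fin ℓ) (i : ℤ) (hi : 2 ≤ i) :
    A.Y (hgen c) i (hgen d) = 0 := by
  rw [zz_gen (A := A) (hgen := hgen) d, zz_comm hH, zz_Hkill _ _ (by omega), if_neg (by omega)]; simp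

theorem zz_H1 (hH : IsHeisenberg A hgen) (c d : Fin ℓ) :
    A.Y (hgen c) 1 (hgen d) = if c = d then A.one else 0 := by
  rw [zz_gen (A := A) (hgen := hgen) d, zz_comm hH, zz_Hkill _ _ (by omega)]
  by_cases h : c = d <;> simp [h]

theorem zz_t0 (hH : IsHeisenberg A hgen) (b d : Fin ℓ) :
    A.Y (SV A hgen b b 1 1) 0 (hgen d) = if b = d then (2 : ℂ) • A.Y (hgen b) (-2) A.one else 0 := by
  rw [zz_quad b b 0 (hgen d) 2 (fun i hi => zz_bd1 hH _ _ _ (by omega)) (fun i hi => zz_bd1 hH _ _ _ (by omega))]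
  simp [Finset.sum_range_succ, zz_H0 hH, zz_H1 hH]
  split_ifs with h
  · rw [two_smul]
  · simp

theorem zz_t1 (hH : IsHeisenberg A hgen) (b d : Fin ℓ) :
    A.Y (SV A hgen b b 1 1) 1 (hgen d) = if b = d then (2 : ℂ) • hgen b else 0 := by
  rw [zz_quad b b 1 (hgen d) 2 (fun i hi => zz_bd1 hH _ _ _ (by omega)) (fun i hi => zz_bd1 hH _ _ _ (by omega))]
  simp [Finset.sum_range_succ, zz_H0 hH, zz_H1 hH, zz_bd1 hH]
  split_ifs with h
  · simp [A.create, two_smul]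
  · simp

theorem zz_h2 (b : Fin ℓ) (n : ℤ) (x : V) : A.Y (A.Y (hgen b) (-2) A.one) n x = (-(n : ℂ)) • A.Y (hgen b) (n - 1) x := by
  have : A.Y A.omega 0 (hgen b) = A.Y (hgen b) (-2) A.one := by
    have h2 := congrArg (fun f : Module.End ℂ V => f A.one) (A.translation (hgen b) (-1))
    simpa [A.create] using h2
  rw [← this, A.translation]; simp

theorem zz_D_same (hH : IsHeisenberg A hgen) (b : Fin ℓ) (n : ℤ) (x : V) :
    zz_D A hgen b (A.Y (hgen b) n x) = A.Y (hgen b) n (zz_D A hgen b x)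
      - (2 * n : ℂ) • (A.Y (hgen b) (n - 1) x + A.Y (hgen b) n x) := by
  simp only [zz_D_apply]
  rw [zz_zero, zz_one, zz_t0 hH, zz_t1 hH]
  simp only [if_true, map_smul, Pi.smul_apply, LinearMap.smul_apply, zz_h2, map_add]
  rw [add_sub_cancel_right]
  push_cast
  module

theorem zz_D_diff (hH : IsHeisenberg A hgen) (b d : Fin ℓ) (hbd : b ≠ d) (n : ℤ) (x : V) :
    zz_D A hgen b (A.Y (hgen d) n x) = A.Y (hgen d) n (zz_D A hgen b x) := by
  simp only [zz_D_apply]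
  rw [zz_zero, zz_one, zz_t0 hH, zz_t1 hH]
  simp [hbd]

theorem zz_D_one (b : Fin ℓ) : zz_D A hgen b A.one = 0 := by
  simp only [zz_D_apply]
  rw [A.create_ge _ _ le_rfl, A.create_ge _ _ zero_le_one, add_zero]

end

section
variable {V : Type} [AddCommGroup V] [Module ℂ V] {A : VOA V} {ℓ : ℕ} {hgen : Fin ℓ → V}

theorem zz_circ_quad (hH : IsHeisenberg A hgen) (c d e f : Fin ℓ) (p q : ℤ) (hp : p < 4) (hq : q < 4) :
    A.circAux 2 (SV A hgen c d 1 1) (SV A hgen e f p q) =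
    (∑ i ∈ Finset.range 6,
      (A.Y (hgen c) (-1 - i) (A.Y (hgen d) (-2 + i) (SV A hgen e f p q)) + A.Y (hgen d) (-2 - 1 - i) (A.Y (hgen c) i (SV A hgen e f p q)))) + (2:ℂ) • (∑ i ∈ Finset.range 6,
      (A.Y (hgen c) (-1 - i) (A.Y (hgen d) (-1 + i) (SV A hgen e f p q)) + A.Y (hgen d) (-1 - 1 - i) (A.Y (hgen c) i (SV A hgen e f p q)))) + (∑ i ∈ Finset.range 6,
      (A.Y (hgen c) (-1 - i) (A.Y (hgen d) (0 + i) (SV A hgen e f p q)) + A.Y (hgen d) (0 - 1 - i) (A.Y (hgen c) i (SV A hgen e f p q)))) := by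
  have h : ∀ (c : Fin ℓ) (i : ℤ), 4 ≤ i → A.Y (hgen c) i (SV A hgen e f p q) = 0 :=
    fun c i hi => zz_bd2 hH c e f p q i (by omega) (by omega) (by omega)
  rw [zz_circ2, zz_quad c d (-2) _ 6 (fun i hi => h _ _ (by omega)) (fun i hi => h _ _ (by omega)),
   zz_quad c d (-1) _ 6 (fun i hi => h _ _ (by omega)) (fun i hi => h _ _ (by omega)),
   zz_quad c d (0) _ 6 (fun i hi => h _ _ (by omega)) (fun i hi => h _ _ (by omega))]

set_option maxHeartbeats 2000000 in
theorem zz_key (hH : IsHeisenberg A hgen) (a b : Fin ℓ) (hab : a ≠ b) :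
    SV A hgen a b 1 6 + (3 : ℂ) • SV A hgen a b 1 5 + (51 / 16 : ℂ) • SV A hgen a b 1 4
      + (11 / 8 : ℂ) • SV A hgen a b 1 3 + (3 / 16 : ℂ) • SV A hgen a b 1 2
    = (1 / 64 : ℂ) • zz_D A hgen b (A.circAux 2 (SV A hgen a b 1 1) (SV A hgen b b 1 2))
      - (1 / 16 : ℂ) • A.circAux 2 (SV A hgen a b 1 1) (SV A hgen b b 1 2)
      - (1 / 16 : ℂ) • A.circAux 2 (SV A hgen a b 1 1) (SV A hgen b b 1 3)
      + (1 / 32 : ℂ) • A.circAux 2 (SV A hgen b b 1 1) (SV A hgen a b 1 3)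
      - (1 / 128 : ℂ) • zz_D A hgen b (A.circAux 2 (SV A hgen b b 1 1) (SV A hgen a b 1 2))
      - (1 / 32 : ℂ) • A.circAux 2 (SV A hgen b b 1 1) (SV A hgen a b 2 2)
      + (1 / 16 : ℂ) • A.circAux 3 (SV A hgen a b 1 2) A.one
      + (23 / 64 : ℂ) • A.circAux 4 (SV A hgen a b 1 3) A.one
      + (167 / 320 : ℂ) • A.circAux 5 (SV A hgen a b 1 4) A.one
      + (9 / 40 : ℂ) • A.circAux 6 (SV A hgen a b 1 5) A.one
      - (1 / 64 : ℂ) • A.circAux 4 (SV A hgen a b 2 2) A.one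
      - (13 / 320 : ℂ) • A.circAux 5 (SV A hgen a b 2 3) A.one
      - (1 / 40 : ℂ) • A.circAux 6 (SV A hgen a b 2 4) A.one
      + (1 / 64 : ℂ) • A.circAux 4 (SV A hgen a b 3 1) A.one
      - (3 / 320 : ℂ) • A.circAux 5 (SV A hgen a b 3 2) A.one
      + (1 / 60 : ℂ) • A.circAux 6 (SV A hgen a b 3 3) A.one
      + (17 / 320 : ℂ) • A.circAux 5 (SV A hgen a b 4 1) A.one
      - (1 / 40 : ℂ) • A.circAux 6 (SV A hgen a b 4 2) A.one
      + (3 / 80 : ℂ) • A.circAux 6 (SV A hgen a b 5 1) A.one := by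
  have hba := hab.symm
  have hN : ∀ (m n : ℤ) (x : V), m < 0 → n < 0 → A.Y (hgen b) m (A.Y (hgen a) n x) = A.Y (hgen a) n (A.Y (hgen b) m x) :=
    fun m n x => zz_commN hH b a m n x
  have hB : ∀ (m n : ℤ) (x : V), m < n → n < 0 → A.Y (hgen b) m (A.Y (hgen b) n x) = A.Y (hgen b) n (A.Y (hgen b) m x) :=
    fun m n x h1 h2 => zz_commN hH b b m n x (by omega) (by omega)
  simp only [zz_T]
  rw [zz_circ_quad hH a b b b 1 2 (by omega) (by omega), zz_circ_quad hH a b b b 1 3 (by omega) (by omega),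
    zz_circ_quad hH b b a b 1 3 (by omega) (by omega), zz_circ_quad hH b b a b 1 2 (by omega) (by omega),
    zz_circ_quad hH b b a b 2 2 (by omega) (by omega)]
  simp (discharger := norm_num) only [Finset.sum_range_succ, Finset.sum_range_zero, SV, zz_H0 hH, zz_Hkill, zz_commP hH, hab, hba, smul_smul,
    hN, hB, map_add, map_smul, map_zero, if_neg, if_true, false_and, true_and, if_false, zero_smul, add_zero, zero_add, smul_zero,
    Nat.cast_zero, Nat.cast_one, Nat.cast_ofNat, Int.reduceNeg, Int.reduceSub, Int.reduceAdd, sub_zero, Int.reduceEq, ↓reduceIte]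
  simp (discharger := norm_num) only [zz_D_same hH, zz_D_diff hH b a hba, zz_D_one, map_zero, zero_sub, map_add, map_smul, map_neg, map_sub,
    hN, hB, Int.reduceNeg, Int.reduceSub, Int.reduceAdd]
  push_cast
  module
end

section
variable {V : Type} [AddCommGroup V] [Module ℂ V] {ℓ : ℕ}

theorem zz_span {A : VOA V} {hgen : Fin ℓ → V} (hH : IsHeisenberg A hgen) {θ : V ≃ₗ[ℂ] V} (hθ : IsThetaAut A hgen θ)
    (OV : Submodule ℂ V)
    (O1 : ∀ (k : ℤ) (u v : V), u ∈ A.wt k → θ u = u → θ v = v → A.circAux k u v ∈ OV)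
    (O2 : ∀ (t : V), t ∈ A.wt 2 → θ t = t → ∀ o ∈ OV, A.Y t 0 o + A.Y t 1 o ∈ OV)
    (a b : Fin ℓ) (hab : a ≠ b) (m n : ℤ) (hm : 1 ≤ m) (hn : 1 ≤ n) :
    ∃ c : Fin 5 → ℂ, SV A hgen a b m n - ∑ i : Fin 5, c i • SV A hgen a b 1 ((i : ℕ) + 1 : ℤ) ∈ OV := by
  have hS : ∀ c d m n, θ (SV A hgen c d m n) = SV A hgen c d m n := by
    intro c d m n
    simp [SV, hθ.map_Y, hθ.map_gen, hθ.map_one]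
  have hD : ∀ o ∈ OV, zz_D A hgen b o ∈ OV := fun o ho => by
    rw [zz_D_apply]
    exact O2 _ (by simpa using zz_S_wt hH b b 1 1) (hS _ _ _ _) o ho
  have hT : ∀ m n : ℤ, A.circAux (m + n) (SV A hgen a b m n) A.one ∈ OV := fun m n =>
    O1 _ _ _ (zz_S_wt hH _ _ _ _) (hS _ _ _ _) hθ.map_one
  have hq : ∀ c d e f p q, A.circAux 2 (SV A hgen c d 1 1) (SV A hgen e f p q) ∈ OV := by
    intro c d e f p q
    exact O1 2 _ _ (by simpa using zz_S_wt hH c d 1 1) (hS _ _ _ _) (hS _ _ _ _)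
  have hkey : SV A hgen a b 1 6 + (3 : ℂ) • SV A hgen a b 1 5 + (51 / 16 : ℂ) • SV A hgen a b 1 4
      + (11 / 8 : ℂ) • SV A hgen a b 1 3 + (3 / 16 : ℂ) • SV A hgen a b 1 2 ∈ OV := by
    rw [zz_key hH a b hab]
    have t := hT 1 2
    have t2 := hT 1 3
    have t3 := hT 1 4
    have t4 := hT 1 5
    have t5 := hT 2 2
    have t6 := hT 2 3
    have t7 := hT 2 4
    have t8 := hT 3 1
    have t9 := hT 3 2
    have t10 := hT 3 3
    have t11 := hT 4 1
    have t12 := hT 4 2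
    have t13 := hT 5 1
    norm_num only at t t2 t3 t4 t5 t6 t7 t8 t9 t10 t11 t12 t13
    repeat' first
      | exact Submodule.smul_mem _ _ (hD _ (hq _ _ _ _ _ _))
      | exact Submodule.smul_mem _ _ (hq _ _ _ _ _ _)
      | exact Submodule.smul_mem _ _ (by assumption)
      | refine Submodule.add_mem _ ?_ ?_
      | refine Submodule.sub_mem _ ?_ ?_
  -- the span
  let U : Submodule ℂ V := Submodule.span ℂ (Set.range fun i : Fin 5 => SV A hgen a b 1 ((i : ℕ) + 1 : ℤ)) ⊔ OV
  have hOU : OV ≤ U := le_sup_right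
  have hb : ∀ i : Fin 5, SV A hgen a b 1 ((i : ℕ) + 1 : ℤ) ∈ U := fun i =>
    Submodule.mem_sup_left (Submodule.subset_span ⟨i, rfl⟩)
  have b1 : SV A hgen a b 1 1 ∈ U := by simpa using hb 0
  have b2 : SV A hgen a b 1 2 ∈ U := by simpa using hb 1
  have b3 : SV A hgen a b 1 3 ∈ U := by simpa using hb 2
  have b4 : SV A hgen a b 1 4 ∈ U := by simpa using hb 3
  have b5 : SV A hgen a b 1 5 ∈ U := by simpa using hb 4
  have b6 : SV A hgen a b 1 6 ∈ U := by
    have h := hOU hkey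
    have e : SV A hgen a b 1 6 = (SV A hgen a b 1 6 + (3 : ℂ) • SV A hgen a b 1 5 + (51 / 16 : ℂ) • SV A hgen a b 1 4
      + (11 / 8 : ℂ) • SV A hgen a b 1 3 + (3 / 16 : ℂ) • SV A hgen a b 1 2) - (3 : ℂ) • SV A hgen a b 1 5 - (51 / 16 : ℂ) • SV A hgen a b 1 4
      - (11 / 8 : ℂ) • SV A hgen a b 1 3 - (3 / 16 : ℂ) • SV A hgen a b 1 2 := by module
    rw [e]
    exact U.sub_mem (U.sub_mem (U.sub_mem (U.sub_mem h (U.smul_mem _ b5)) (U.smul_mem _ b4)) (U.smul_mem _ b3)) (U.smul_mem _ b2)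
  have hDS : ∀ n : ℤ, zz_D A hgen b (SV A hgen a b 1 n) = (2 * n : ℂ) • SV A hgen a b 1 (n + 1) + (2 * n : ℂ) • SV A hgen a b 1 n := by
    intro n
    unfold SV
    rw [zz_D_diff hH b a hab.symm, zz_D_same hH, zz_D_one]
    simp only [map_zero, zero_sub, map_neg, map_smul, map_add, neg_add_rev]
    rw [show -n - 1 = -1 + -n by ring]
    push_cast
    module
  have hDU : ∀ x ∈ U, zz_D A hgen b x ∈ U := by
    intro x hx
    obtain ⟨y, hy, z, hz, rfl⟩ := Submodule.mem_sup.mp hx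
    rw [map_add]
    refine U.add_mem ?_ (hOU (hD _ hz))
    clear hx
    induction hy using Submodule.span_induction with
    | mem y hy =>
      obtain ⟨i, rfl⟩ := hy
      simp only
      rw [hDS]
      refine U.add_mem (U.smul_mem _ ?_) (U.smul_mem _ (hb i))
      fin_cases i <;> simpa
    | zero => simp
    | add x y hx' hy' hx hy =>
      rw [map_add]
      exact U.add_mem hx hy
    | smul c x hx' hx =>
      rw [map_smul]
      exact U.smul_mem _ hx
  have h1 : ∀ n : ℕ, SV A hgen a b 1 ((n : ℤ) + 1) ∈ U := by
    intro n
    induction n with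
    | zero => simpa using b1
    | succ n ih =>
      have h := hDU _ ih
      rw [hDS] at h
      have hne : (2 * (((n : ℤ) + 1 : ℤ) : ℂ)) ≠ 0 := by
        push_cast
        have : (n : ℂ) + 1 ≠ 0 := by exact_mod_cast Nat.succ_ne_zero n
        simpa using this
      have := (U.add_mem_iff_left (U.smul_mem _ ih)).mp h
      rw [U.smul_mem_iff hne] at this
      simpa using this
  have h2 : ∀ m n : ℕ, SV A hgen a b ((m : ℤ) + 1) ((n : ℤ) + 1) ∈ U := by
    intro m
    induction m with
    | zero => intro n; simpa using h1 n
    | succ m ih =>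
      intro n
      have h := hOU (hT ((m : ℤ) + 1) ((n : ℤ) + 1))
      rw [zz_T] at h
      have h' := (U.add_mem_iff_left (U.smul_mem _ (ih n))).mp h
      have h3 := ih (n + 1)
      push_cast at h3
      have h'' := (U.add_mem_iff_left (U.smul_mem _ h3)).mp h'
      have hne : ((((m : ℤ) + 1 : ℤ) : ℂ)) ≠ 0 := by
        push_cast
        exact_mod_cast Nat.succ_ne_zero m
      rw [U.smul_mem_iff hne] at h''
      simpa using h''
  have hfin := h2 (m - 1).toNat (n - 1).toNat
  rw [show ((m - 1).toNat : ℤ) + 1 = m by omega, show ((n - 1).toNat : ℤ) + 1 = n by omega] at hfin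
  obtain ⟨y, hy, z, hz, e⟩ := Submodule.mem_sup.mp hfin
  obtain ⟨c, rfl⟩ := (Submodule.mem_span_range_iff_exists_fun ℂ).mp hy
  exact ⟨c, by rw [← e]; simpa using hz⟩

variable {W : Type} [AddCommGroup W] [Module ℂ W] (S : HeisenbergPlusSetting ℓ V W)

theorem zz_fix {x : V} (hx : S.θ x = x) : ∃ w, S.ι w = x := by
  have : x ∈ LinearMap.range S.ι := by
    rw [S.fixedSub.range_eq, Module.End.mem_eigenspace_iff]
    simpa using hx
  exact this

theorem zz_iota_fix (w : W) : S.θ (S.ι w) = S.ι w := by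
  have : S.ι w ∈ LinearMap.range S.ι := ⟨w, rfl⟩
  rw [S.fixedSub.range_eq, Module.End.mem_eigenspace_iff] at this
  simpa using this

theorem zz_iota_circ (k : ℤ) (u v : W) : S.ι (S.B.circAux k u v) = S.A.circAux k (S.ι u) (S.ι v) := by
  obtain ⟨N, h⟩ := zz_trunc S.B u v
  rw [zz_circ S.B k u v (N + 2) (fun i hi => h _ (by omega)), zz_circ S.A k _ _ (N + 2)
    (fun i hi => by rw [← S.fixedSub.map_Y, h _ (by omega), map_zero])]
  simp [S.fixedSub.map_Y]

theorem zz_O1 (k : ℤ) (u v : V) (hu : u ∈ S.A.wt k) (hu' : S.θ u = u) (hv : S.θ v = v) :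
    S.A.circAux k u v ∈ S.B.Osub.map S.ι := by
  obtain ⟨u, rfl⟩ := zz_fix S hu'
  obtain ⟨v, rfl⟩ := zz_fix S hv
  rw [← zz_iota_circ]
  exact Submodule.mem_map_of_mem (Submodule.subset_span ⟨k, u, v, (S.fixedSub.map_wt _ _).mpr hu, rfl⟩)

theorem zz_O2 (t : V) (ht : t ∈ S.A.wt 2) (ht' : S.θ t = t) (o : V) (ho : o ∈ S.B.Osub.map S.ι) :
    S.A.Y t 0 o + S.A.Y t 1 o ∈ S.B.Osub.map S.ι := by
  obtain ⟨o, ho, rfl⟩ := ho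
  induction ho using Submodule.span_induction with
  | mem x hx =>
    obtain ⟨k, u, v, hu, rfl⟩ := hx
    have hu2 := (S.fixedSub.map_wt _ _).mp hu
    rw [zz_iota_circ, zz_D_circ]
    have f : ∀ n w, S.θ (S.A.Y t n (S.ι w)) = S.A.Y t n (S.ι w) := by
      intro n w
      rw [S.thetaAut.map_Y, ht', zz_iota_fix]
    refine Submodule.add_mem _ (Submodule.add_mem _ ?_ ?_) ?_
    · refine zz_O1 S _ _ _ ?_ (f _ _) (zz_iota_fix S _)
      convert S.A.mode_wt 2 t ht k 0 _ hu2 using 2; ring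
    · refine zz_O1 S _ _ _ ?_ (f _ _) (zz_iota_fix S _)
      convert S.A.mode_wt 2 t ht k 1 _ hu2 using 2; ring
    · refine zz_O1 S _ _ _ hu2 (zz_iota_fix S _) ?_
      rw [map_add, f, f]
  | zero => simp
  | add x y _ _ hx hy =>
    have := Submodule.add_mem _ hx hy
    convert this using 1
    simp only [map_add]; abel
  | smul c x _ hx =>
    have := Submodule.smul_mem _ c hx
    convert this using 1
    simp

end

section
variable {V : Type} [AddCommGroup V] [Module ℂ V] {ℓ : ℕ}

/-- `∑ f_i h_c(p+i)` -/
noncomputable def zz_Op (A : VOA V) (hgen : Fin ℓ → V) (c : Fin ℓ) (p : ℤ) (f : ℕ → ℂ) : V →ₗ[ℂ] V where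
  toFun x := ∑ᶠ i : ℕ, f i • A.Y (hgen c) (p + i) x
  map_add' x y := by
    obtain ⟨N1, h1⟩ := zz_trunc A (hgen c) x
    obtain ⟨N2, h2⟩ := zz_trunc A (hgen c) y
    rw [zz_fsum _ (N1 + N2 + p.natAbs), zz_fsum _ (N1 + N2 + p.natAbs), zz_fsum _ (N1 + N2 + p.natAbs)]
    · simp [Finset.sum_add_distrib]
    · intro i hi; rw [h2 _ (by omega), smul_zero]
    · intro i hi; rw [h1 _ (by omega), smul_zero]
    · intro i hi; rw [map_add, h1 _ (by omega), h2 _ (by omega), add_zero, smul_zero]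
  map_smul' a x := by
    obtain ⟨N1, h1⟩ := zz_trunc A (hgen c) x
    rw [zz_fsum _ (N1 + p.natAbs), zz_fsum _ (N1 + p.natAbs)]
    · simp [Finset.smul_sum, smul_comm a]
    · intro i hi; rw [h1 _ (by omega), smul_zero]
    · intro i hi; rw [map_smul, h1 _ (by omega), smul_zero, smul_zero]

variable {A : VOA V} {hgen : Fin ℓ → V}

theorem zz_Op_eq (c : Fin ℓ) (p : ℤ) (f : ℕ → ℂ) (x : V) (N : ℕ)
    (h : ∀ i : ℤ, N + p ≤ i → A.Y (hgen c) i x = 0) :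
    zz_Op A hgen c p f x = ∑ i ∈ Finset.range N, f i • A.Y (hgen c) (p + i) x := by
  change ∑ᶠ i : ℕ, f i • A.Y (hgen c) (p + i) x = _
  rw [zz_fsum _ N]
  intro i hi
  rw [h _ (by omega), smul_zero]

theorem zz_Op_one (c : Fin ℓ) (p : ℤ) (hp : 0 ≤ p) (f : ℕ → ℂ) : zz_Op A hgen c p f A.one = 0 := by
  rw [zz_Op_eq c p f A.one 0 (fun i hi => A.create_ge _ _ (by omega))]
  simp

theorem zz_Op_trunc (c : Fin ℓ) (x : V) : ∃ N : ℕ, ∀ p : ℤ, N ≤ p → ∀ f, zz_Op A hgen c p f x = 0 := by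
  obtain ⟨N, h⟩ := zz_trunc A (hgen c) x
  refine ⟨N, fun p hp f => ?_⟩
  rw [zz_Op_eq c p f x 0 (fun i hi => h _ (by omega))]
  simp

theorem zz_Op_comm_aux (hH : IsHeisenberg A hgen) (c d : Fin ℓ) (p q : ℤ) (f g : ℕ → ℂ) (x : V) :
    ∃ N0 : ℕ, ∀ N : ℕ, N0 ≤ N →
    zz_Op A hgen c p f (zz_Op A hgen d q g x) = zz_Op A hgen d q g (zz_Op A hgen c p f x)
      + ∑ i ∈ Finset.range N, ∑ j ∈ Finset.range N,
        (f i * g j) • (if c = d ∧ (p + i) + (q + j) = 0 then ((p + i : ℤ) : ℂ) else 0) • x := by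
  obtain ⟨N1, h1⟩ := zz_trunc A (hgen c) x
  obtain ⟨N2, h2⟩ := zz_trunc A (hgen d) x
  obtain ⟨N3, h3⟩ := zz_trunc A (hgen c) (zz_Op A hgen d q g x)
  obtain ⟨N4, h4⟩ := zz_trunc A (hgen d) (zz_Op A hgen c p f x)
  refine ⟨N1 + N2 + N3 + N4 + p.natAbs + q.natAbs, fun N hN => ?_⟩
  rw [zz_Op_eq c p f (zz_Op A hgen d q g x) N (fun i hi => h3 i (by omega)),
    zz_Op_eq d q g (zz_Op A hgen c p f x) N (fun i hi => h4 i (by omega)),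
    zz_Op_eq d q g x N (fun i hi => h2 i (by omega)),
    zz_Op_eq c p f x N (fun i hi => h1 i (by omega))]
  simp only [map_sum, map_smul, Finset.smul_sum]
  rw [Finset.sum_comm (s := Finset.range N) (t := Finset.range N) (f := fun j i => g j • f i • _)]
  rw [← Finset.sum_add_distrib]
  apply Finset.sum_congr rfl
  intro i _
  rw [← Finset.sum_add_distrib]
  apply Finset.sum_congr rfl
  intro j _
  rw [zz_comm hH]
  module

theorem zz_Op_comm0 (hH : IsHeisenberg A hgen) (c d : Fin ℓ) (p q : ℤ) (h : c ≠ d ∨ 0 < p + q)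
    (f g : ℕ → ℂ) (x : V) :
    zz_Op A hgen c p f (zz_Op A hgen d q g x) = zz_Op A hgen d q g (zz_Op A hgen c p f x) := by
  obtain ⟨N, hN⟩ := zz_Op_comm_aux hH c d p q f g x
  rw [hN N le_rfl, Finset.sum_eq_zero, add_zero]
  intro i _
  apply Finset.sum_eq_zero
  intro j _
  rw [if_neg]
  · simp
  · rintro ⟨h1, h2⟩
    rcases h with h | h
    · exact h h1
    · omega

theorem zz_Op_comm (hH : IsHeisenberg A hgen) (c d : Fin ℓ) (p q : ℤ) (s : ℕ) (hs : p + q = -(s : ℤ))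
    (f g : ℕ → ℂ) (x : V) :
    zz_Op A hgen c p f (zz_Op A hgen d q g x) = zz_Op A hgen d q g (zz_Op A hgen c p f x)
     + (if c = d then ∑ ij ∈ Finset.HasAntidiagonal.antidiagonal s, ((p : ℂ) + (ij.1 : ℂ)) * (f ij.1 * g ij.2) else 0) • x := by
  by_cases hcd : c = d
  swap
  · rw [zz_Op_comm0 hH c d p q (Or.inl hcd), if_neg hcd]; simp
  obtain ⟨N, hN⟩ := zz_Op_comm_aux hH c d p q f g x
  rw [hN (N + s + 1) (by omega), if_pos hcd]
  congr 1
  rw [Finset.Nat.sum_antidiagonal_eq_sum_range_succ (fun i j => ((p : ℂ) + (i : ℂ)) * (f i * g j)), Finset.sum_smul]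
  have hin : ∀ i ∈ Finset.range (N + s + 1), ∑ j ∈ Finset.range (N + s + 1),
      (f i * g j) • (if c = d ∧ (p + i) + (q + j) = 0 then ((p + i : ℤ) : ℂ) else 0) • x
      = if i < s + 1 then (((p : ℂ) + (i : ℂ)) * (f i * g (s - i))) • x else 0 := by
    intro i hi
    split_ifs with h
    · rw [Finset.sum_eq_single (s - i)]
      · rw [if_pos ⟨hcd, by omega⟩, smul_smul, mul_comm]
        push_cast
        rfl
      · intro j _ hj
        rw [if_neg (by omega)]; simp
      · intro hj
        simp at hj
        omega
    · apply Finset.sum_eq_zero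
      intro j _
      rw [if_neg (by omega)]; simp
  rw [Finset.sum_congr rfl hin, ← Finset.sum_filter]
  apply Finset.sum_congr _ (fun _ _ => rfl)
  ext i
  simp
  omega

end

section
variable {V : Type} [AddCommGroup V] [Module ℂ V] {ℓ : ℕ}

/-- twisted modes -/
noncomputable def zz_hh (A : VOA V) (hgen : Fin ℓ → V) (r : ℂ) (c : Fin ℓ) (p : ℤ) : V →ₗ[ℂ] V :=
  zz_Op A hgen c p (Ring.choose r)

/-- words in the twisted modes -/
noncomputable def zz_hw (A : VOA V) (hgen : Fin ℓ → V) (r : ℂ) : List (Fin ℓ × ℕ) → V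
  | [] => A.one
  | (c, n) :: L => zz_hh A hgen r c (-((n : ℤ) + 1)) (zz_hw A hgen r L)

variable {A : VOA V} {hgen : Fin ℓ → V} {r : ℂ}

theorem zz_sym (s : ℕ) (p : ℂ) (f : ℕ → ℂ) :
    ∑ ij ∈ Finset.HasAntidiagonal.antidiagonal s, (p + (ij.1 : ℂ)) * (f ij.1 * f ij.2)
    = (p + s / 2) * ∑ ij ∈ Finset.HasAntidiagonal.antidiagonal s, f ij.1 * f ij.2 := by
  have h1 : ∑ ij ∈ Finset.HasAntidiagonal.antidiagonal s, (p + (ij.1 : ℂ)) * (f ij.1 * f ij.2)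
    = ∑ ij ∈ Finset.HasAntidiagonal.antidiagonal s, (p + (ij.2 : ℂ)) * (f ij.1 * f ij.2) := by
    rw [← Finset.Nat.sum_antidiagonal_swap]
    apply Finset.sum_congr rfl
    intro ij _
    simp [mul_comm]
  have h2 : 2 * ∑ ij ∈ Finset.HasAntidiagonal.antidiagonal s, (p + (ij.1 : ℂ)) * (f ij.1 * f ij.2)
     = 2 * ((p + s / 2) * ∑ ij ∈ Finset.HasAntidiagonal.antidiagonal s, f ij.1 * f ij.2) := by
    rw [two_mul]
    nth_rewrite 2 [h1]
    rw [← Finset.sum_add_distrib, Finset.mul_sum, Finset.mul_sum]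
    apply Finset.sum_congr rfl
    intro ij hij
    have : (s : ℂ) = ij.1 + ij.2 := by
      rw [← Finset.HasAntidiagonal.mem_antidiagonal.mp hij]; push_cast; rfl
    rw [this]; ring
  exact mul_left_cancel₀ two_ne_zero h2

theorem zz_choose_2r (hr : r = 0 ∨ r = 1 / 2) (s : ℕ) : Ring.choose (r + r) (s + 2) = 0 := by
  rcases hr with rfl | rfl
  · rw [add_zero, Ring.choose_zero_succ]
  · have := Ring.choose_natCast (R := ℂ) 1 (s + 2)
    rw [Nat.cast_one, Nat.choose_eq_zero_of_lt (by omega)] at this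
    norm_num
    simpa using this

theorem zz_hh_comm (hH : IsHeisenberg A hgen) (hr : r = 0 ∨ r = 1 / 2) (c d : Fin ℓ) (m n : ℕ) (x : V) :
    zz_hh A hgen r c (-((m : ℤ) + 1)) (zz_hh A hgen r d (-((n : ℤ) + 1)) x)
      = zz_hh A hgen r d (-((n : ℤ) + 1)) (zz_hh A hgen r c (-((m : ℤ) + 1)) x) := by
  unfold zz_hh
  rw [zz_Op_comm hH c d _ _ (m + n + 2) (by push_cast; ring), zz_sym,
    ← Ring.add_choose_eq _ (Commute.all r r), zz_choose_2r hr]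
  simp

/-- annihilator with eigenvalues of binomial type -/
noncomputable def zz_E (A : VOA V) (hgen : Fin ℓ → V) (τ : ℂ) (c : Fin ℓ) : V →ₗ[ℂ] V :=
  zz_Op A hgen c 1 (fun i => Ring.choose τ i / (i + 1))

theorem zz_E_comm (hH : IsHeisenberg A hgen) (τ : ℂ) (c d : Fin ℓ) (n : ℕ) (x : V) :
    zz_E A hgen τ c (zz_hh A hgen r d (-((n : ℤ) + 1)) x)
      = zz_hh A hgen r d (-((n : ℤ) + 1)) (zz_E A hgen τ c x)
        + (if c = d then Ring.choose (τ + r) n else 0) • x := by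
  unfold zz_hh zz_E
  rw [zz_Op_comm hH c d _ _ n (by push_cast; ring), Ring.add_choose_eq _ (Commute.all τ r)]
  congr 3
  apply Finset.sum_congr rfl
  intro ij _
  have : (ij.1 : ℂ) + 1 ≠ 0 := Nat.cast_add_one_ne_zero _
  push_cast
  field_simp
  ring

theorem zz_E_one (τ : ℂ) (c : Fin ℓ) : zz_E A hgen τ c A.one = 0 := zz_Op_one c 1 (by norm_num) _

/-- dual annihilators -/
noncomputable def zz_P (A : VOA V) (hgen : Fin ℓ → V) (r : ℂ) (c : Fin ℓ) (n : ℕ) : V →ₗ[ℂ] V :=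
  zz_Op A hgen c ((n : ℤ) + 1) (fun i => Ring.choose (-r) i / (n + 1 + i))

theorem zz_P_comm (hH : IsHeisenberg A hgen) (c d : Fin ℓ) (m n : ℕ) (x : V) :
    zz_P A hgen r c m (zz_hh A hgen r d (-((n : ℤ) + 1)) x)
      = zz_hh A hgen r d (-((n : ℤ) + 1)) (zz_P A hgen r c m x)
        + (if c = d ∧ m = n then (1 : ℂ) else 0) • x := by
  unfold zz_hh zz_P
  by_cases hmn : n < m
  · rw [zz_Op_comm0 hH c d _ _ (Or.inr (by omega)), if_neg (by omega)]; simp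
  rw [zz_Op_comm hH c d _ _ (n - m) (by omega)]
  have e : ∑ ij ∈ Finset.HasAntidiagonal.antidiagonal (n - m), ((((m : ℤ) + 1 : ℤ) : ℂ) + (ij.1 : ℂ)) *
      ((Ring.choose (-r) ij.1 / (m + 1 + ij.1)) * Ring.choose r ij.2) = if m = n then 1 else 0 := by
    have : ∀ ij : ℕ × ℕ, ((((m : ℤ) + 1 : ℤ) : ℂ) + (ij.1 : ℂ)) *
      ((Ring.choose (-r) ij.1 / (m + 1 + ij.1)) * Ring.choose r ij.2) = Ring.choose (-r) ij.1 * Ring.choose r ij.2 := by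
      intro ij
      have : (m : ℂ) + 1 + ij.1 ≠ 0 := by exact_mod_cast (show m + 1 + ij.1 ≠ 0 by omega)
      push_cast
      field_simp
    simp only [this]
    rw [← Ring.add_choose_eq _ (Commute.all (-r) r), neg_add_cancel]
    split_ifs with h
    · subst h; simp
    · rw [show n - m = (n - m - 1) + 1 by omega, Ring.choose_zero_succ]
  rw [e]
  congr 2
  split_ifs <;> simp_all

theorem zz_P_one (c : Fin ℓ) (n : ℕ) : zz_P A hgen r c n A.one = 0 := zz_Op_one c _ (by omega) _

theorem zz_P_trunc (x : V) : ∃ N : ℕ, ∀ n, N ≤ n → ∀ c, zz_P A hgen r c n x = 0 := by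
  choose N hN using fun c : Fin ℓ => zz_Op_trunc (A := A) (hgen := hgen) c x
  refine ⟨∑ c, N c, fun n hn c => hN c _ ?_ _⟩
  have := Finset.single_le_sum (f := N) (fun _ _ => Nat.zero_le _) (Finset.mem_univ c)
  omega

/-- number operator -/
noncomputable def zz_Num (A : VOA V) (hgen : Fin ℓ → V) (r : ℂ) : V →ₗ[ℂ] V where
  toFun x := ∑ᶠ n : ℕ, ∑ c : Fin ℓ, zz_hh A hgen r c (-((n : ℤ) + 1)) (zz_P A hgen r c n x)
  map_add' x y := by
    obtain ⟨N1, h1⟩ := zz_P_trunc (A := A) (hgen := hgen) (r := r) x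
    obtain ⟨N2, h2⟩ := zz_P_trunc (A := A) (hgen := hgen) (r := r) y
    rw [zz_fsum _ (N1 + N2), zz_fsum _ (N1 + N2), zz_fsum _ (N1 + N2)]
    · simp [Finset.sum_add_distrib]
    · intro i hi; simp [h2 _ (show N2 ≤ i by omega)]
    · intro i hi; simp [h1 _ (show N1 ≤ i by omega)]
    · intro i hi; simp [h1 _ (show N1 ≤ i by omega), h2 _ (show N2 ≤ i by omega)]
  map_smul' a x := by
    obtain ⟨N1, h1⟩ := zz_P_trunc (A := A) (hgen := hgen) (r := r) x
    rw [zz_fsum _ N1, zz_fsum _ N1]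
    · simp [Finset.smul_sum]
    · intro i hi; simp [h1 _ hi]
    · intro i hi; simp [h1 _ hi]

theorem zz_Num_eq (x : V) (N : ℕ) (h : ∀ n, N ≤ n → ∀ c, zz_P A hgen r c n x = 0) :
    zz_Num A hgen r x = ∑ n ∈ Finset.range N, ∑ c : Fin ℓ, zz_hh A hgen r c (-((n : ℤ) + 1)) (zz_P A hgen r c n x) := by
  change ∑ᶠ n : ℕ, ∑ c : Fin ℓ, zz_hh A hgen r c (-((n : ℤ) + 1)) (zz_P A hgen r c n x) = _
  rw [zz_fsum _ N]
  intro i hi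
  simp [h i hi]

theorem zz_Num_comm (hH : IsHeisenberg A hgen) (hr : r = 0 ∨ r = 1 / 2) (d : Fin ℓ) (m : ℕ) (x : V) :
    zz_Num A hgen r (zz_hh A hgen r d (-((m : ℤ) + 1)) x)
      = zz_hh A hgen r d (-((m : ℤ) + 1)) (zz_Num A hgen r x) + zz_hh A hgen r d (-((m : ℤ) + 1)) x := by
  obtain ⟨N1, h1⟩ := zz_P_trunc (A := A) (hgen := hgen) (r := r) x
  obtain ⟨N2, h2⟩ := zz_P_trunc (A := A) (hgen := hgen) (r := r) (zz_hh A hgen r d (-((m : ℤ) + 1)) x)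
  rw [zz_Num_eq x (N1 + N2 + m + 1) (fun n hn => h1 n (by omega)),
    zz_Num_eq (zz_hh A hgen r d (-((m : ℤ) + 1)) x) (N1 + N2 + m + 1) (fun n hn => h2 n (by omega))]
  simp only [zz_P_comm hH, map_add, map_smul, Finset.sum_add_distrib, map_sum]
  congr 1
  · apply Finset.sum_congr rfl
    intro n _
    apply Finset.sum_congr rfl
    intro c _
    exact zz_hh_comm hH hr _ _ _ _ _
  · rw [Finset.sum_eq_single m]
    · rw [Finset.sum_eq_single d]
      · simp
      · intro c _ hc; simp [hc]
      · simp
    · intro n _ hn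
      apply Finset.sum_eq_zero
      intro c _
      simp [hn]
    · intro h; simp at h

theorem zz_Num_word (hH : IsHeisenberg A hgen) (hr : r = 0 ∨ r = 1 / 2) (L : List (Fin ℓ × ℕ)) :
    zz_Num A hgen r (zz_hw A hgen r L) = (L.length : ℂ) • zz_hw A hgen r L := by
  induction L with
  | nil =>
    rw [zz_hw, zz_Num_eq _ 0 (fun n _ c => zz_P_one c n)]; simp
  | cons p L ih =>
    obtain ⟨c, n⟩ := p
    rw [zz_hw, zz_Num_comm hH hr, ih, map_smul]
    simp [add_smul]

theorem zz_hw_span (hH : IsHeisenberg A hgen) (r : ℂ) : Submodule.span ℂ (Set.range (zz_hw A hgen r)) = ⊤ := by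
  set U := Submodule.span ℂ (Set.range (zz_hw A hgen r)) with hU
  have hUw : ∀ L, zz_hw A hgen r L ∈ U := fun L => Submodule.subset_span ⟨L, rfl⟩
  have hst : ∀ T : V →ₗ[ℂ] V, (∀ L, T (zz_hw A hgen r L) ∈ U) → ∀ x ∈ U, T x ∈ U := by
    intro T hT x hx
    have : U ≤ U.comap T := by
      rw [hU, Submodule.span_le]
      rintro _ ⟨L, rfl⟩
      exact hT L
    exact this hx
  have hh : ∀ c (n : ℕ), ∀ x ∈ U, zz_hh A hgen r c (-((n : ℤ) + 1)) x ∈ U := fun c n =>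
    hst _ (fun L => hUw ((c, n) :: L))
  have hop : ∀ (n : ℕ) (c : Fin ℓ) (g : ℕ → ℂ), ∀ x ∈ U, zz_Op A hgen c (-(n : ℤ)) g x ∈ U := by
    intro n
    induction n with
    | zero =>
      intro c g
      apply hst
      intro L
      induction L with
      | nil => rw [zz_hw, zz_Op_one _ _ (by simp)]; exact U.zero_mem
      | cons p L ih =>
        obtain ⟨d, m⟩ := p
        rw [zz_hw, zz_hh, zz_Op_comm hH c d _ _ (m + 1) (by push_cast; ring)]
        exact U.add_mem (hh d m _ ih) (U.smul_mem _ (hUw L))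
    | succ n ih =>
      intro c g x hx
      have e : zz_Op A hgen c (-((n + 1 : ℕ) : ℤ)) g x = g 0 • zz_hh A hgen r c (-((n : ℤ) + 1)) x
         + zz_Op A hgen c (-(n : ℤ)) (fun i => g (i + 1) - g 0 * Ring.choose r (i + 1)) x := by
        obtain ⟨N, hN⟩ := zz_trunc A (hgen c) x
        unfold zz_hh
        rw [zz_Op_eq c _ _ x (N + n + 1 + 1) (fun i hi => hN i (by omega)), zz_Op_eq c _ _ x (N + n + 1 + 1) (fun i hi => hN i (by omega)),
          zz_Op_eq c _ _ x (N + n + 1) (fun i hi => hN i (by omega))]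
        rw [Finset.sum_range_succ' _ (N + n + 1), Finset.sum_range_succ' _ (N + n + 1), smul_add, Finset.smul_sum]
        rw [add_right_comm (∑ _ ∈ _, g 0 • _), ← Finset.sum_add_distrib]
        congr 1
        · apply Finset.sum_congr rfl
          intro i _
          push_cast
          rw [show -((n : ℤ) + 1) + (i + 1) = -n + i by ring]
          module
        · simp
      rw [e]
      exact U.add_mem (U.smul_mem _ (hh c n x hx)) (ih c _ x hx)
  rw [eq_top_iff]
  intro v _
  refine zz_word_ind hH (fun v => v ∈ U) (hUw []) U.zero_mem (fun x y => U.add_mem) (fun c x => U.smul_mem c) ?_ v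
  intro a n x hn hx
  have := hop n a (fun i => if i = 0 then 1 else 0) x hx
  obtain ⟨N, hN⟩ := zz_trunc A (hgen a) x
  rw [zz_Op_eq a _ _ x (N + n + 1) (fun i hi => hN i (by omega)), Finset.sum_range_succ'] at this
  simpa using this

theorem zz_F0 (hH : IsHeisenberg A hgen) (hr : r = 0 ∨ r = 1 / 2) : ∃ F : V →ₗ[ℂ] ℂ, F A.one = 1 ∧
    ∀ c (n : ℕ) x, F (zz_hh A hgen r c (-((n : ℤ) + 1)) x) = 0 := by
  let U : Submodule ℂ V := ⨆ k : {k : ℂ // k ≠ 0}, Module.End.eigenspace (zz_Num A hgen r : Module.End ℂ V) k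
  have hone : A.one ∉ U := by
    intro h
    have hi := Module.End.eigenspaces_iSupIndep (zz_Num A hgen r : Module.End ℂ V) 0
    have h0 : A.one ∈ Module.End.eigenspace (zz_Num A hgen r : Module.End ℂ V) 0 := by
      rw [Module.End.mem_eigenspace_iff]
      simpa [zz_hw] using zz_Num_word hH hr []
    have h' : A.one ∈ ⨆ j, ⨆ (_ : j ≠ 0), Module.End.eigenspace (zz_Num A hgen r : Module.End ℂ V) j := by
      rw [iSup_subtype'] ; exact h
    have := Submodule.disjoint_def.mp hi A.one h0 h'
    exact A.one_ne_zero this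
  have hU : ∀ c (n : ℕ) x, zz_hh A hgen r c (-((n : ℤ) + 1)) x ∈ U := by
    intro c n x
    have hx : x ∈ Submodule.span ℂ (Set.range (zz_hw A hgen r)) := by rw [zz_hw_span hH]; trivial
    have : Submodule.span ℂ (Set.range (zz_hw A hgen r)) ≤ U.comap (zz_hh A hgen r c (-((n : ℤ) + 1))) := by
      rw [Submodule.span_le]
      rintro _ ⟨L, rfl⟩
      have hne : ((((c, n) :: L).length : ℕ) : ℂ) ≠ 0 := Nat.cast_ne_zero.mpr (by simp)
      refine Submodule.mem_iSup_of_mem (⟨_, hne⟩ : {k : ℂ // k ≠ 0}) ?_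
      rw [Module.End.mem_eigenspace_iff]
      exact zz_Num_word hH hr ((c, n) :: L)
    exact this hx
  obtain ⟨f, hf, hfU⟩ := Submodule.exists_le_ker_of_notMem hone
  refine ⟨(f A.one)⁻¹ • f, ?_, ?_⟩
  · simp [hf]
  · intro c n x
    have := hfU (hU c n x)
    rw [LinearMap.mem_ker] at this
    rw [LinearMap.smul_apply, this, smul_zero]

theorem zz_theta_hh {θ : V ≃ₗ[ℂ] V} (hθ : IsThetaAut A hgen θ) (c : Fin ℓ) (p : ℤ) (x : V) :
    θ (zz_hh A hgen r c p x) = - zz_hh A hgen r c p (θ x) := by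
  obtain ⟨N, hN⟩ := zz_trunc A (hgen c) x
  unfold zz_hh
  have hh : ∀ i : ℤ, θ (A.Y (hgen c) i x) = - A.Y (hgen c) i (θ x) := by
    intro i
    rw [hθ.map_Y, hθ.map_gen]; simp
  rw [zz_Op_eq c _ _ x (N + p.natAbs) (fun i hi => hN i (by omega)), zz_Op_eq c _ _ (θ x) (N + p.natAbs)
    (fun i hi => by rw [← neg_eq_zero, ← hh, hN i (by omega), map_zero])]
  simp [hh]

theorem zz_theta_word {θ : V ≃ₗ[ℂ] V} (hθ : IsThetaAut A hgen θ) (L : List (Fin ℓ × ℕ)) :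
    θ (zz_hw A hgen r L) = (-1 : ℂ) ^ L.length • zz_hw A hgen r L := by
  induction L with
  | nil => simp [zz_hw, hθ.map_one]
  | cons p L ih =>
    obtain ⟨c, n⟩ := p
    rw [zz_hw, zz_theta_hh hθ, ih, map_smul, List.length_cons, pow_succ]
    simp

theorem zz_even (hH : IsHeisenberg A hgen) {θ : V ≃ₗ[ℂ] V} (hθ : IsThetaAut A hgen θ) (r : ℂ) (u : V) (hu : θ u = u) :
    u ∈ Submodule.span ℂ {x | ∃ L : List (Fin ℓ × ℕ), Even L.length ∧ x = zz_hw A hgen r L} := by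
  set U := Submodule.span ℂ {x | ∃ L : List (Fin ℓ × ℕ), Even L.length ∧ x = zz_hw A hgen r L} with hU
  have h : ∀ v : V, v + θ v ∈ U := by
    intro v
    have hv : v ∈ Submodule.span ℂ (Set.range (zz_hw A hgen r)) := by rw [zz_hw_span hH]; trivial
    induction hv using Submodule.span_induction with
    | mem x hx =>
      obtain ⟨L, rfl⟩ := hx
      rw [zz_theta_word hθ]
      rcases Nat.even_or_odd L.length with h | h
      · have : zz_hw A hgen r L ∈ U := Submodule.subset_span ⟨L, h, rfl⟩
        exact U.add_mem this (U.smul_mem _ this)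
      · rw [h.neg_one_pow]; simp
    | zero => simp
    | add x y _ _ hx hy =>
      rw [map_add, add_add_add_comm]; exact U.add_mem hx hy
    | smul c x _ hx => rw [map_smul, ← smul_add]; exact U.smul_mem _ hx
  have := h u
  rw [hu, ← two_smul ℂ] at this
  exact (U.smul_mem_iff two_ne_zero).mp this

end

section

/-- `(1+z)^s` as a Laurent series -/
noncomputable def zz_xs (s : ℂ) : LaurentSeries ℂ := HahnSeries.ofPowerSeries ℤ ℂ (PowerSeries.binomialSeries ℂ s)

theorem zz_xs_add (s t : ℂ) : zz_xs (s + t) = zz_xs s * zz_xs t := by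
  unfold zz_xs; rw [PowerSeries.binomialSeries_add, map_mul]

theorem zz_xs_zero : zz_xs 0 = 1 := by
  unfold zz_xs; rw [PowerSeries.binomialSeries_zero, map_one]

theorem zz_xs_coeff (s : ℂ) (n : ℕ) : (zz_xs s).coeff (n : ℤ) = Ring.choose s n := by
  unfold zz_xs
  rw [HahnSeries.ofPowerSeries_apply_coeff, PowerSeries.binomialSeries_coeff]; simp

theorem zz_xs_coeff_neg (s : ℂ) (n : ℤ) (hn : n < 0) : (zz_xs s).coeff n = 0 := by
  unfold zz_xs
  rw [HahnSeries.ofPowerSeries_apply, HahnSeries.embDomain_of_notMem_range]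
  rintro ⟨m, hm⟩
  simp at hm
  omega

theorem zz_xs_mul_coeff (s : ℂ) (R : LaurentSeries ℂ) (t : ℤ) (M : ℕ)
    (h : ∀ j : ℤ, M ≤ j → R.coeff (t - j) = 0) :
    (zz_xs s * R).coeff t = ∑ j ∈ Finset.range M, Ring.choose s j * R.coeff (t - j) := by
  rw [HahnSeries.coeff_mul]
  refine Finset.sum_bij_ne_zero (fun ij _ _ => ij.1.toNat) ?_ ?_ ?_ ?_
  · rintro ⟨i, j⟩ h1 h2
    simp only [Finset.mem_antidiagonal] at h1
    obtain ⟨h3, h4, h5⟩ := h1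
    have hi : 0 ≤ i := by
      by_contra hc
      exact h3 (zz_xs_coeff_neg s i (by omega))
    simp only [Finset.mem_range]
    by_contra hc
    apply h4
    have := h i (by omega)
    rwa [show t - i = j by omega] at this
  · rintro ⟨i, j⟩ h1 h2 ⟨i', j'⟩ h1' h2' e
    simp only [Finset.mem_antidiagonal] at h1 h1'
    have hi : 0 ≤ i := by
      by_contra hc
      exact h1.1 (zz_xs_coeff_neg s i (by omega))
    have hi' : 0 ≤ i' := by
      by_contra hc
      exact h1'.1 (zz_xs_coeff_neg s i' (by omega))
    simp only at e
    obtain rfl : i = i' := by omega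
    simp only [Prod.mk.injEq, true_and]
    omega
  · intro j hj h2
    refine ⟨((j : ℤ), t - j), ?_, ?_, ?_⟩
    · simp only [Finset.mem_antidiagonal, HahnSeries.mem_support]
      refine ⟨?_, right_ne_zero_of_mul h2, by ring⟩
      rw [zz_xs_coeff]
      exact left_ne_zero_of_mul h2
    · simp only [zz_xs_coeff]; exact h2
    · simp
  · rintro ⟨i, j⟩ h1 h2
    simp only [Finset.mem_antidiagonal] at h1
    have hi : 0 ≤ i := by
      by_contra hc
      exact h1.1 (zz_xs_coeff_neg s i (by omega))
    obtain ⟨n, rfl⟩ := Int.eq_ofNat_of_zero_le hi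
    simp only at *
    rw [zz_xs_coeff]
    simp only [Int.toNat_natCast]
    rw [show t - (n : ℤ) = j by omega]

theorem zz_smul_mul (c : ℂ) (x y : LaurentSeries ℂ) : c • (x * y) = x * (c • y) := by
  rw [← HahnSeries.C_mul_eq_smul, ← HahnSeries.C_mul_eq_smul]; ring

/-- left multiplication -/
noncomputable def zz_ml (x : LaurentSeries ℂ) : LaurentSeries ℂ →ₗ[ℂ] LaurentSeries ℂ where
  toFun y := x * y
  map_add' := mul_add x
  map_smul' c y := (zz_smul_mul c x y).symm

theorem zz_ml_apply (x y : LaurentSeries ℂ) : zz_ml x y = x * y := rfl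

variable {V : Type} [AddCommGroup V] [Module ℂ V] {ℓ : ℕ}

/-- matrix coefficient series `f (Y(u,z) v)` -/
noncomputable def zz_R (A : VOA V) (f : V →ₗ[ℂ] ℂ) (v : V) : V →ₗ[ℂ] LaurentSeries ℂ where
  toFun u := HahnSeries.ofSuppBddBelow (fun t : ℤ => f (A.Y u (-t - 1) v)) (by
    obtain ⟨N, hN⟩ := zz_trunc A u v
    refine ⟨-N - 1, ?_⟩
    intro t ht
    by_contra hc
    apply ht
    simp only
    rw [hN _ (by omega), map_zero])
  map_add' x y := by
    ext t; simp
  map_smul' a x := by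
    ext t; simp

theorem zz_R_coeff (A : VOA V) (f : V →ₗ[ℂ] ℂ) (u v : V) (t : ℤ) :
    (zz_R A f v u).coeff t = f (A.Y u (-t - 1) v) := rfl

/-- weighted matrix coefficient -/
noncomputable def zz_Xi (A : VOA V) (f : V →ₗ[ℂ] ℂ) (v : V) : V →ₗ[ℂ] LaurentSeries ℂ :=
  (DirectSum.toModule ℂ ℤ (LaurentSeries ℂ)
    (fun k => zz_ml (zz_xs (k : ℂ)) ∘ₗ (zz_R A f v) ∘ₗ (A.wt k).subtype)) ∘ₗ A.decompose.toLinearMap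

theorem zz_Xi_eq (A : VOA V) (f : V →ₗ[ℂ] ℂ) (v u : V) (k : ℤ) (hu : u ∈ A.wt k) :
    zz_Xi A f v u = zz_xs k * zz_R A f v u := by
  have : A.decompose u = DirectSum.lof ℂ ℤ (fun k => A.wt k) k ⟨u, hu⟩ := by
    unfold VOA.decompose
    rw [LinearEquiv.symm_apply_eq]
    exact (DirectSum.coeLinearMap_lof A.wt k ⟨u, hu⟩).symm
  unfold zz_Xi
  simp [this, zz_ml_apply]

theorem zz_Xi_zero (A : VOA V) (v : V) : zz_Xi A 0 v = 0 := by
  have h : zz_R A 0 v = 0 := by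
    ext u t
    rw [zz_R_coeff]; rfl
  unfold zz_Xi
  rw [h]
  ext u
  simp only [LinearMap.zero_comp, LinearMap.comp_zero, LinearMap.comp_apply, LinearMap.zero_apply]
  rw [show DirectSum.toModule ℂ ℤ (LaurentSeries ℂ) (fun k => (0 : A.wt k →ₗ[ℂ] LaurentSeries ℂ)) = 0 from ?_]
  · simp
  · apply DirectSum.linearMap_ext
    intro i
    ext x
    simp

theorem zz_Xi_ext (A : VOA V) (f g : V →ₗ[ℂ] LaurentSeries ℂ) (h : ∀ k : ℤ, ∀ u ∈ A.wt k, f u = g u) : f = g := by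
  ext1 u
  have hu : u ∈ ⨆ k, A.wt k := by rw [A.internal.submodule_iSup_eq_top]; trivial
  induction hu using Submodule.iSup_induction' with
  | mem i x hx => exact h i x hx
  | zero => simp
  | add x y _ _ hx hy => rw [map_add, map_add, hx, hy]

end

section
variable {V : Type} [AddCommGroup V] [Module ℂ V] {ℓ : ℕ} {A : VOA V} {hgen : Fin ℓ → V} {r : ℂ}

theorem zz_bound {x : ℕ → V} (u : ℕ → V) (N : ℕ) : ∃ J : ℕ, ∀ i < N, ∀ n : ℤ, J ≤ n → A.Y (u i) n (x i) = 0 := by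
  choose J hJ using fun i => zz_trunc A (u i) (x i)
  refine ⟨∑ i ∈ Finset.range N, J i, fun i hi n hn => hJ i n ?_⟩
  have := Finset.single_le_sum (f := J) (fun _ _ => Nat.zero_le _) (Finset.mem_range.mpr hi)
  omega

theorem zz_choose_shift (r : ℂ) (i j : ℕ) :
    Ring.choose r (i + j) * ((i + j).choose i : ℂ) = Ring.choose r i * Ring.choose (r - i) j := by
  have := Ring.choose_smul_choose r (Nat.le_add_right i j)
  rw [Nat.add_sub_cancel_left, nsmul_eq_mul] at this
  rw [← this, mul_comm]

theorem zz_tri (N M J : ℕ) (hM : N + J ≤ M) (r : ℂ) (g : ℕ → ℕ → V) (hg : ∀ i < N, ∀ j, J ≤ j → g i j = 0)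
   (k : ℕ → ℕ → V) (hk : ∀ i j, k (i + j) i = g i j) :
   ∑ m ∈ Finset.range M, Ring.choose r m • ∑ i ∈ Finset.range N, Ring.choose (m : ℂ) i • k m i
    = ∑ i ∈ Finset.range N, ∑ j ∈ Finset.range J, (Ring.choose r i * Ring.choose (r - i) j) • g i j := by
  simp only [Finset.smul_sum]
  rw [Finset.sum_comm]
  apply Finset.sum_congr rfl
  intro i hi
  rw [Finset.mem_range] at hi
  rw [show M = i + (M - i) by omega, Finset.sum_range_add, Finset.sum_eq_zero, zero_add]
  · have : ∀ j, Ring.choose r (i + j) • Ring.choose (((i + j : ℕ)) : ℂ) i • k (i + j) i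
       = (Ring.choose r i * Ring.choose (r - i) j) • g i j := by
      intro j
      rw [hk, Ring.choose_natCast, smul_smul, zz_choose_shift]
    simp only [this]
    apply zz_sum_ext
    · intro j hj; rw [hg i hi j (by omega), smul_zero]
    · intro j hj; rw [hg i hi j (by omega), smul_zero]
  · intro m hm
    rw [Finset.mem_range] at hm
    rw [Ring.choose_natCast, Nat.choose_eq_zero_of_lt hm]; simp

theorem zz_core (c : Fin ℓ) (n0 : ℕ) (k : ℤ) (u w : V) :
    ∃ N0 : ℕ, ∀ N, N0 ≤ N → ∃ J0 : ℕ, ∀ J, J0 ≤ J →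
    ∑ i ∈ Finset.range N, ∑ j ∈ Finset.range J, (Ring.choose r i * Ring.choose (r - i) j) •
      A.Y (A.Y (hgen c) (-((n0 : ℤ) + 1) + i) u) (k + j) w
    = ∑ i ∈ Finset.range N, ((n0 + i).choose i : ℂ) •
        (zz_hh A hgen r c (-((n0 : ℤ) + 1) - i) (A.Y u (k + i) w)
          + (-1 : ℂ) ^ n0 • A.Y u (k - ((n0 : ℤ) + 1) - i) (zz_hh A hgen r c i w)) := by
  obtain ⟨N1, h1⟩ := zz_trunc A (hgen c) u
  obtain ⟨N2, h2⟩ := zz_trunc A u w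
  obtain ⟨N3, h3⟩ := zz_trunc A (hgen c) w
  refine ⟨N1 + N2 + N3 + n0 + 1 + k.natAbs, fun N hN => ?_⟩
  obtain ⟨J1, hJ1⟩ := zz_bound (A := A) (x := fun _ => w) (fun i => A.Y (hgen c) (-((n0 : ℤ) + 1) + i) u) N
  obtain ⟨J2, hJ2⟩ := zz_bound (A := A) (x := fun i => A.Y u (k + i) w) (fun _ => hgen c) N
  refine ⟨J1 + k.natAbs, fun J hJ => ?_⟩
  set M := N + J + J2 + n0 + 1 + N3 with hMd
  have hb : ∀ m : ℕ, _ := fun m : ℕ => zz_borch A (hgen c) u w (-((n0 : ℤ) + 1)) m k N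
    (fun i hi => h1 i (by omega)) (fun i hi => h2 i (by omega)) (fun i hi => h3 i (by omega))
  have hsum := Finset.sum_congr (s₁ := Finset.range M) rfl (fun m (_ : m ∈ Finset.range M) =>
    congrArg (fun x => Ring.choose r m • x) (hb m))
  have hl := zz_tri N M J (by omega) r
    (fun i j => A.Y (A.Y (hgen c) (-((n0 : ℤ) + 1) + i) u) (k + j) w)
    (fun i hi j hj => hJ1 i hi _ (by omega))
    (fun m i => A.Y (A.Y (hgen c) (-((n0 : ℤ) + 1) + i) u) ((m : ℤ) + k - i) w)
    (fun i j => by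
      congr 2
      push_cast
      ring_nf)
  simp only [Int.cast_natCast] at hsum
  rw [← hl, hsum]
  simp only [Finset.smul_sum]
  rw [Finset.sum_comm]
  apply Finset.sum_congr rfl
  intro i hi
  rw [Finset.mem_range] at hi
  have e1 : ((-1 : ℂ) ^ i * Ring.choose (((-((n0 : ℤ) + 1) : ℤ)) : ℂ) i) = ((n0 + i).choose i : ℂ) := by
    rw [← zz_choose_neg]; push_cast; rfl
  have e2 : (-1 : ℂ) ^ (-((n0 : ℤ) + 1)) = - (-1) ^ n0 := by
    rw [zpow_neg, zpow_add_one₀ (by norm_num), zpow_natCast, mul_neg_one, inv_neg, ← inv_pow]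
    norm_num
  simp only [e1, e2]
  unfold zz_hh
  rw [zz_Op_eq c _ _ (A.Y u (k + i) w) M (fun j hj => hJ2 i hi j (by omega)),
    zz_Op_eq c _ _ w M (fun j hj => h3 j (by omega))]
  rw [map_sum, Finset.smul_sum, ← Finset.sum_add_distrib, Finset.smul_sum]
  apply Finset.sum_congr rfl
  intro m _
  rw [map_smul, show (m : ℤ) + -((n0 : ℤ) + 1) - i = -((n0 : ℤ) + 1) - i + m by ring,
    show k + -((n0 : ℤ) + 1) - i = k - ((n0 : ℤ) + 1) - i by ring, add_comm (m : ℤ) (i : ℤ)]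
  module

end

section
variable {V : Type} [AddCommGroup V] [Module ℂ V] {ℓ : ℕ} {A : VOA V} {hgen : Fin ℓ → V} {r : ℂ}

theorem zz_rec_R (c : Fin ℓ) (n0 : ℕ) (u w : V) (f f1 f2 : V →ₗ[ℂ] ℂ) (β1 β2 l1 l2 : ℂ)
    (hf : ∀ (n : ℕ) (x : V), f (zz_hh A hgen r c (-((n : ℤ) + 1)) x)
      = l1 * Ring.choose β1 n * f1 x + l2 * Ring.choose β2 n * f2 x)
    (N1 : ℕ) (h1 : ∀ i : ℤ, N1 ≤ i + ((n0 : ℤ) + 1) → A.Y (hgen c) i u = 0)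
    (h2 : ∀ i : ℤ, N1 ≤ i → A.Y (hgen c) i w = 0) :
    ∑ i ∈ Finset.range N1, Ring.choose r i • (zz_xs (r - i) * zz_R A f w (A.Y (hgen c) (-((n0 : ℤ) + 1) + i) u))
    = (l1 * Ring.choose β1 n0) • (zz_xs (β1 - n0) * zz_R A f1 w u)
      + (l2 * Ring.choose β2 n0) • (zz_xs (β2 - n0) * zz_R A f2 w u)
      + ∑ i ∈ Finset.range N1, ((n0 + i).choose i * (-1 : ℂ) ^ n0) •
        (HahnSeries.single (-((n0 : ℤ) + 1) - i) (1 : ℂ) * zz_R A f (zz_hh A hgen r c i w) u) := by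
  ext t
  obtain ⟨N0, hN0⟩ := zz_core (A := A) (hgen := hgen) (r := r) c n0 (-t - 1) u w
  obtain ⟨N2, h3⟩ := zz_trunc A u w
  set N := N0 + N1 + N2 + t.natAbs + 1 with hN
  obtain ⟨J0, hJ0⟩ := hN0 N (by omega)
  obtain ⟨J1, hJ1⟩ := zz_bound (A := A) (x := fun _ => w) (fun i => A.Y (hgen c) (-((n0 : ℤ) + 1) + i) u) N1
  have key := congrArg f (hJ0 (J0 + J1 + t.natAbs + 1) (by omega))
  have hhw : ∀ i : ℕ, N1 ≤ i → zz_hh A hgen r c i w = 0 := by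
    intro i hi
    unfold zz_hh
    rw [zz_Op_eq c _ _ w 0 (fun j hj => h2 j (by omega))]; simp
  simp only [map_sum, map_smul, map_add] at key
  simp only [HahnSeries.coeff_add, HahnSeries.coeff_smul, HahnSeries.coeff_sum]
  have e1 : ∀ i < N1, (zz_xs (r - i) * zz_R A f w (A.Y (hgen c) (-((n0 : ℤ) + 1) + i) u)).coeff t
     = ∑ j ∈ Finset.range (J0 + J1 + t.natAbs + 1), Ring.choose (r - i) j *
        f (A.Y (A.Y (hgen c) (-((n0 : ℤ) + 1) + i) u) (-t - 1 + j) w) := by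
    intro i hi
    rw [zz_xs_mul_coeff _ _ _ (J0 + J1 + t.natAbs + 1)]
    · apply Finset.sum_congr rfl
      intro j _
      rw [zz_R_coeff, show -(t - (j : ℤ)) - 1 = -t - 1 + j by ring]
    · intro j hj
      rw [zz_R_coeff, hJ1 i hi _ (by omega), map_zero]
  have e2 : ∀ (g : V →ₗ[ℂ] ℂ) (β : ℂ), (zz_xs β * zz_R A g w u).coeff t
     = ∑ i ∈ Finset.range N, Ring.choose β i * g (A.Y u (-t - 1 + i) w) := by
    intro g β
    rw [zz_xs_mul_coeff _ _ _ N]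
    · apply Finset.sum_congr rfl
      intro j _
      rw [zz_R_coeff, show -(t - (j : ℤ)) - 1 = -t - 1 + j by ring]
    · intro j hj
      rw [zz_R_coeff, h3 _ (by omega), map_zero]
  have e3 : ∀ i : ℕ, (HahnSeries.single (-((n0 : ℤ) + 1) - i) (1 : ℂ) * zz_R A f (zz_hh A hgen r c i w) u).coeff t
     = f (A.Y u (-t - 1 - ((n0 : ℤ) + 1) - i) (zz_hh A hgen r c i w)) := by
    intro i
    rw [HahnSeries.coeff_single_mul, one_mul, zz_R_coeff]
    congr 3
    ring_nf
  rw [e2, e2]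
  simp only [e3]
  have e4 : ∑ x ∈ Finset.range N1, Ring.choose r x • (zz_xs (r - x) * zz_R A f w (A.Y (hgen c) (-((n0 : ℤ) + 1) + x) u)).coeff t
     = ∑ x ∈ Finset.range N1, ∑ j ∈ Finset.range (J0 + J1 + t.natAbs + 1), (Ring.choose r x * Ring.choose (r - x) j) •
        f (A.Y (A.Y (hgen c) (-((n0 : ℤ) + 1) + x) u) (-t - 1 + j) w) := by
    apply Finset.sum_congr rfl
    intro i hi
    rw [e1 i (Finset.mem_range.mp hi), Finset.smul_sum]
    apply Finset.sum_congr rfl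
    intro j _
    simp only [smul_eq_mul]; ring
  rw [e4]
  rw [zz_sum_ext _ N1 N, key]
  · rw [zz_sum_ext (fun x : ℕ => ((n0 + x).choose x * (-1 : ℂ) ^ n0) • f (A.Y u (-t - 1 - ((n0 : ℤ) + 1) - x) (zz_hh A hgen r c x w))) N1 N]
    · rw [Finset.smul_sum, Finset.smul_sum, ← Finset.sum_add_distrib, ← Finset.sum_add_distrib]
      apply Finset.sum_congr rfl
      intro i _
      rw [show -((n0 : ℤ) + 1) - i = -(((n0 + i : ℕ) : ℤ) + 1) by push_cast; ring, hf]
      have s1 := zz_choose_shift β1 n0 i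
      have s2 := zz_choose_shift β2 n0 i
      have s3 : (n0 + i).choose i = (n0 + i).choose n0 := by
        rw [Nat.choose_symm_add]
      rw [s3]
      simp only [smul_eq_mul]
      linear_combination l1 * f1 (A.Y u (-t - 1 + i) w) * s1 + l2 * f2 (A.Y u (-t - 1 + i) w) * s2
    · intro i hi; rw [hhw i hi]; simp
    · intro i hi; rw [hhw i (by omega)]; simp
  · intro i hi
    apply Finset.sum_eq_zero
    intro j _
    rw [h1 _ (by omega)]; simp
  · intro i hi
    apply Finset.sum_eq_zero
    intro j _
    rw [h1 _ (by omega)]; simp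

theorem zz_rec (hH : IsHeisenberg A hgen) (c : Fin ℓ) (n0 : ℕ) (u w : V) (f f1 f2 : V →ₗ[ℂ] ℂ) (σ l1 l2 : ℂ)
    (hf : ∀ (n : ℕ) (x : V), f (zz_hh A hgen r c (-((n : ℤ) + 1)) x)
      = l1 * Ring.choose (σ + r - 1) n * f1 x + l2 * Ring.choose (-σ + r - 1) n * f2 x) :
    ∃ N : ℕ, zz_Xi A f w (zz_hh A hgen r c (-((n0 : ℤ) + 1)) u)
    = (l1 * Ring.choose (σ + r - 1) n0) • (zz_xs σ * zz_Xi A f1 w u)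
      + (l2 * Ring.choose (-σ + r - 1) n0) • (zz_xs (-σ) * zz_Xi A f2 w u)
      + ∑ i ∈ Finset.range N, ((n0 + i).choose i * (-1 : ℂ) ^ n0) •
        (zz_xs (n0 + 1 - r) * HahnSeries.single (-((n0 : ℤ) + 1) - i) (1 : ℂ) * zz_Xi A f (zz_hh A hgen r c i w) u) := by
  obtain ⟨N, hN⟩ := zz_trunc A (hgen c) w
  refine ⟨N, ?_⟩
  let T : V →ₗ[ℂ] LaurentSeries ℂ := (l1 * Ring.choose (σ + r - 1) n0) • (zz_ml (zz_xs σ) ∘ₗ zz_Xi A f1 w)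
      + (l2 * Ring.choose (-σ + r - 1) n0) • (zz_ml (zz_xs (-σ)) ∘ₗ zz_Xi A f2 w)
      + ∑ i ∈ Finset.range N, ((n0 + i).choose i * (-1 : ℂ) ^ n0) •
        (zz_ml (zz_xs (n0 + 1 - r) * HahnSeries.single (-((n0 : ℤ) + 1) - i) (1 : ℂ)) ∘ₗ zz_Xi A f (zz_hh A hgen r c i w))
  have hT : zz_Xi A f w ∘ₗ zz_hh A hgen r c (-((n0 : ℤ) + 1)) = T := by
    apply zz_Xi_ext A
    intro k u hu
    obtain ⟨N1, h1⟩ := zz_trunc A (hgen c) u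
    have hrec := zz_rec_R (r := r) c n0 u w f f1 f2 _ _ l1 l2 hf (N + N1 + n0 + 1) (fun i hi => h1 i (by omega)) (fun i hi => hN i (by omega))
    have hmul := congrArg (fun x => zz_xs (k + n0 + 1 - r) * x) hrec
    simp only [mul_add, Finset.mul_sum, ← zz_smul_mul, ← mul_assoc, ← zz_xs_add] at hmul
    simp only [T, LinearMap.comp_apply, LinearMap.add_apply, LinearMap.smul_apply, zz_ml_apply, LinearMap.sum_apply]
    simp only [zz_Xi_eq A _ _ u k hu, ← mul_assoc, ← zz_xs_add]
    have hl : zz_Xi A f w (zz_hh A hgen r c (-((n0 : ℤ) + 1)) u) =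
        ∑ i ∈ Finset.range (N + N1 + n0 + 1), Ring.choose r i • (zz_xs (k + n0 + 1 - r + (r - i)) * zz_R A f w (A.Y (hgen c) (-((n0 : ℤ) + 1) + i) u)) := by
      unfold zz_hh
      rw [zz_Op_eq c _ _ u (N + N1 + n0 + 1) (fun i hi => h1 i (by omega)), map_sum]
      apply Finset.sum_congr rfl
      intro i _
      rw [map_smul, zz_Xi_eq A f w _ _ (A.mode_wt 1 _ (hH.wt_one c) k (-((n0 : ℤ) + 1) + i) u hu)]
      rw [show (((k + 1 - (-((n0 : ℤ) + 1) + i) - 1 : ℤ)) : ℂ) = k + n0 + 1 - r + (r - i) by push_cast; ring]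
    rw [hl, hmul]
    rw [show (k : ℂ) + n0 + 1 - r + (σ + r - 1 - n0) = σ + k by ring,
      show (k : ℂ) + n0 + 1 - r + (-σ + r - 1 - n0) = -σ + k by ring]
    refine congrArg₂ (· + ·) rfl ?_
    · rw [zz_sum_ext _ (N + N1 + n0 + 1) N]
      · apply Finset.sum_congr rfl
        intro i _
        rw [show (k : ℂ) + n0 + 1 - r = n0 + 1 - r + k by ring, zz_xs_add]
        refine congrArg (fun x => ((n0 + i).choose i * (-1 : ℂ) ^ n0) • x) ?_
        ring
      · intro i hi
        have : zz_hh A hgen r c i w = 0 := by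
          unfold zz_hh
          rw [zz_Op_eq c _ _ w 0 (fun j hj => hN j (by omega))]; simp
        have h0 : zz_R A f 0 u = 0 := by ext t; rw [zz_R_coeff]; simp
        rw [this, h0]; simp
      · intro i hi
        have : zz_hh A hgen r c i w = 0 := by
          unfold zz_hh
          rw [zz_Op_eq c _ _ w 0 (fun j hj => hN j (by omega))]; simp
        have h0 : zz_R A f 0 u = 0 := by ext t; rw [zz_R_coeff]; simp
        rw [this, h0]; simp
  have := LinearMap.congr_fun hT u
  simpa [T, zz_ml_apply] using this

end

section

/-- Laurent series without positive powers -/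
noncomputable def zz_PP : Submodule ℂ (LaurentSeries ℂ) where
  carrier := {x | ∀ t : ℤ, 0 < t → x.coeff t = 0}
  add_mem' := by
    intro x y hx hy t ht
    rw [HahnSeries.coeff_add, hx t ht, hy t ht, add_zero]
  zero_mem' := by intro t _; rfl
  smul_mem' := by
    intro c x hx t ht
    rw [HahnSeries.coeff_smul, hx t ht, smul_zero]

theorem zz_PP_mul (x y : LaurentSeries ℂ) (hx : x ∈ zz_PP) (hy : y ∈ zz_PP) : x * y ∈ zz_PP := by
  intro t ht
  rw [HahnSeries.coeff_mul]
  apply Finset.sum_eq_zero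
  rintro ⟨i, j⟩ h
  simp only [Finset.mem_antidiagonal] at h
  obtain ⟨h1, h2, h3⟩ := h
  exfalso
  by_cases hi : 0 < i
  · exact h1 (hx i hi)
  · exact h2 (hy j (by omega))

theorem zz_PP_kap (q : ℕ) (m : ℤ) (h : (q : ℤ) ≤ m) (s : ℂ) (hs : s = q) :
    zz_xs s * HahnSeries.single (-m) (1 : ℂ) ∈ zz_PP := by
  intro t ht
  rw [HahnSeries.coeff_mul_single, mul_one]
  obtain ⟨n, hn⟩ := Int.eq_ofNat_of_zero_le (show 0 ≤ t - -m by omega)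
  rw [hn]
  rw [zz_xs_coeff, hs, Ring.choose_natCast, Nat.choose_eq_zero_of_lt (by omega), Nat.cast_zero]

variable {V : Type} [AddCommGroup V] [Module ℂ V] {ℓ : ℕ} {A : VOA V} {hgen : Fin ℓ → V} {r : ℂ}

theorem zz_kap (hH : IsHeisenberg A hgen) (r σ : ℂ) (hσ : (r = 0 ∧ (σ = 0 ∨ σ = 1 ∨ σ = -1)) ∨ (r = 1 / 2 ∧ (σ = 1 / 2 ∨ σ = - (1 / 2))))
    (c : Fin ℓ) (n0 i : ℕ) (w : V) : zz_hh A hgen r c i w = 0 ∨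
    (zz_xs σ * (zz_xs (n0 + 1 - r) * HahnSeries.single (-((n0 : ℤ) + 1) - i) (1 : ℂ)) ∈ zz_PP ∧
     zz_xs (-σ) * (zz_xs (n0 + 1 - r) * HahnSeries.single (-((n0 : ℤ) + 1) - i) (1 : ℂ)) ∈ zz_PP) := by
  have e : -((n0 : ℤ) + 1) - i = -(n0 + 1 + i) := by ring
  rw [e, ← mul_assoc, ← mul_assoc, ← zz_xs_add, ← zz_xs_add]
  rcases hσ with ⟨rfl, h⟩ | ⟨rfl, h⟩
  · by_cases hi : i = 0
    · left
      subst hi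
      obtain ⟨N, hN⟩ := zz_trunc A (hgen c) w
      unfold zz_hh
      rw [zz_Op_eq c _ _ w (N + 1) (fun j hj => hN j (by push_cast at hj; omega)), Finset.sum_range_succ', Finset.sum_eq_zero]
      · simp [zz_H0 hH]
      · intro j _; rw [Ring.choose_zero_succ, zero_smul]
    · right
      rcases h with rfl | rfl | rfl
      · exact ⟨zz_PP_kap (n0 + 1) _ (by push_cast; omega) _ (by push_cast; ring), zz_PP_kap (n0 + 1) _ (by push_cast; omega) _ (by push_cast; ring)⟩
      · exact ⟨zz_PP_kap (n0 + 2) _ (by push_cast; omega) _ (by push_cast; ring), zz_PP_kap n0 _ (by push_cast; omega) _ (by push_cast; ring)⟩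
      · exact ⟨zz_PP_kap n0 _ (by push_cast; omega) _ (by push_cast; ring), zz_PP_kap (n0 + 2) _ (by push_cast; omega) _ (by push_cast; ring)⟩
  · right
    rcases h with rfl | rfl
    · exact ⟨zz_PP_kap (n0 + 1) _ (by push_cast; omega) _ (by push_cast; ring), zz_PP_kap n0 _ (by push_cast; omega) _ (by push_cast; ring)⟩
    · exact ⟨zz_PP_kap n0 _ (by push_cast; omega) _ (by push_cast; ring), zz_PP_kap (n0 + 1) _ (by push_cast; omega) _ (by push_cast; ring)⟩

theorem zz_Xi_v0 (f : V →ₗ[ℂ] ℂ) (u : V) : zz_Xi A f 0 u = 0 := by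
  have h : zz_Xi A f 0 = 0 := by
    apply zz_Xi_ext A
    intro k u hu
    have h0 : zz_R A f 0 u = 0 := by ext t; rw [zz_R_coeff]; simp
    rw [zz_Xi_eq A f 0 u k hu, h0, mul_zero]; rfl
  rw [h]; rfl

theorem zz_Xi_one (f : V →ₗ[ℂ] ℂ) (v : V) : zz_Xi A f v A.one ∈ zz_PP := by
  rw [zz_Xi_eq A f v _ 0 A.one_wt, Int.cast_zero, zz_xs_zero, one_mul]
  intro t ht
  rw [zz_R_coeff, A.vacuum_act, if_neg (by omega)]; simp

theorem zz_rec_mem (hH : IsHeisenberg A hgen) (c : Fin ℓ) (n0 : ℕ) (u w : V) (f f1 f2 : V →ₗ[ℂ] ℂ) (σ l1 l2 : ℂ)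
    (hf : ∀ (n : ℕ) (x : V), f (zz_hh A hgen r c (-((n : ℤ) + 1)) x)
      = l1 * Ring.choose (σ + r - 1) n * f1 x + l2 * Ring.choose (-σ + r - 1) n * f2 x)
    (P : Submodule ℂ (LaurentSeries ℂ)) (h1 : zz_xs σ * zz_Xi A f1 w u ∈ P)
    (h2 : zz_xs (-σ) * zz_Xi A f2 w u ∈ P)
    (h3 : ∀ i : ℕ, zz_xs (n0 + 1 - r) * HahnSeries.single (-((n0 : ℤ) + 1) - i) (1 : ℂ) * zz_Xi A f (zz_hh A hgen r c i w) u ∈ P) :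
    zz_Xi A f w (zz_hh A hgen r c (-((n0 : ℤ) + 1)) u) ∈ P := by
  obtain ⟨N, e⟩ := zz_rec hH c n0 u w f f1 f2 σ l1 l2 hf
  rw [e]
  exact P.add_mem (P.add_mem (P.smul_mem _ h1) (P.smul_mem _ h2)) (P.sum_mem fun i _ => P.smul_mem _ (h3 i))

/-- multiplier submodule -/
noncomputable def zz_Q (s : ℂ) : Submodule ℂ (LaurentSeries ℂ) := zz_PP.comap (zz_ml (zz_xs s))

theorem zz_mem_Q (s : ℂ) (x : LaurentSeries ℂ) : x ∈ zz_Q s ↔ zz_xs s * x ∈ zz_PP := Iff.rfl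

theorem zz_xs_cancel (s : ℂ) (x : LaurentSeries ℂ) : zz_xs s * (zz_xs (-s) * x) = x := by
  rw [← mul_assoc, ← zz_xs_add, add_neg_cancel, zz_xs_zero, one_mul]

theorem zz_xs_cancel' (s : ℂ) (x : LaurentSeries ℂ) : zz_xs (-s) * (zz_xs s * x) = x := by
  rw [← mul_assoc, ← zz_xs_add, neg_add_cancel, zz_xs_zero, one_mul]

theorem zz_words (hH : IsHeisenberg A hgen) (σ : ℂ) (hσ : (r = 0 ∧ (σ = 0 ∨ σ = 1 ∨ σ = -1)) ∨ (r = 1 / 2 ∧ (σ = 1 / 2 ∨ σ = - (1 / 2))))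
    (F0 Fp Fm Fpm : V →ₗ[ℂ] ℂ) (l m : Fin ℓ → ℂ)
    (h0 : ∀ c (n : ℕ) (x : V), F0 (zz_hh A hgen r c (-((n : ℤ) + 1)) x) = 0)
    (hp : ∀ c (n : ℕ) (x : V), Fp (zz_hh A hgen r c (-((n : ℤ) + 1)) x) = l c * Ring.choose (σ + r - 1) n * F0 x)
    (hm : ∀ c (n : ℕ) (x : V), Fm (zz_hh A hgen r c (-((n : ℤ) + 1)) x) = m c * Ring.choose (-σ + r - 1) n * F0 x)
    (hpm : ∀ c (n : ℕ) (x : V), Fpm (zz_hh A hgen r c (-((n : ℤ) + 1)) x) =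
      l c * Ring.choose (σ + r - 1) n * Fm x + m c * Ring.choose (-σ + r - 1) n * Fp x)
    (L : List (Fin ℓ × ℕ)) :
    (Even L.length → ∀ v, zz_Xi A F0 v (zz_hw A hgen r L) ∈ zz_PP ∧ zz_Xi A Fp v (zz_hw A hgen r L) ∈ zz_PP
      ∧ zz_Xi A Fm v (zz_hw A hgen r L) ∈ zz_PP ∧ zz_Xi A Fpm v (zz_hw A hgen r L) ∈ zz_PP) ∧
    (¬ Even L.length → ∀ v, (zz_Xi A F0 v (zz_hw A hgen r L) ∈ zz_Q σ ∧ zz_Xi A F0 v (zz_hw A hgen r L) ∈ zz_Q (-σ))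
      ∧ zz_Xi A Fp v (zz_hw A hgen r L) ∈ zz_Q (-σ)
      ∧ zz_Xi A Fm v (zz_hw A hgen r L) ∈ zz_Q σ ∧ zz_Xi A Fpm v (zz_hw A hgen r L) ∈ zz_Q σ ⊔ zz_Q (-σ)) := by
  have hkQ : ∀ c (n0 i : ℕ) (w : V) (f : V →ₗ[ℂ] ℂ) (u : V), zz_Xi A f (zz_hh A hgen r c i w) u ∈ zz_PP →
      zz_xs (n0 + 1 - r) * HahnSeries.single (-((n0 : ℤ) + 1) - i) (1 : ℂ) * zz_Xi A f (zz_hh A hgen r c i w) u ∈ zz_Q σ ∧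
      zz_xs (n0 + 1 - r) * HahnSeries.single (-((n0 : ℤ) + 1) - i) (1 : ℂ) * zz_Xi A f (zz_hh A hgen r c i w) u ∈ zz_Q (-σ) := by
    intro c n0 i w f u hx
    rcases zz_kap hH r σ hσ c n0 i w with h | ⟨ha, hb⟩
    · rw [h, zz_Xi_v0, mul_zero]; exact ⟨Submodule.zero_mem _, Submodule.zero_mem _⟩
    · rw [zz_mem_Q, zz_mem_Q, ← mul_assoc, ← mul_assoc (zz_xs (-σ))]
      exact ⟨zz_PP_mul _ _ ha hx, zz_PP_mul _ _ hb hx⟩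
  have hkP : ∀ c (n0 i : ℕ) (w : V) (f : V →ₗ[ℂ] ℂ) (u : V), zz_Xi A f (zz_hh A hgen r c i w) u ∈ zz_Q σ ⊔ zz_Q (-σ) →
      zz_xs (n0 + 1 - r) * HahnSeries.single (-((n0 : ℤ) + 1) - i) (1 : ℂ) * zz_Xi A f (zz_hh A hgen r c i w) u ∈ zz_PP := by
    intro c n0 i w f u hx
    rcases zz_kap hH r σ hσ c n0 i w with h | ⟨ha, hb⟩
    · rw [h, zz_Xi_v0, mul_zero]; exact Submodule.zero_mem _
    · obtain ⟨y, hy, z, hz, hyz⟩ := Submodule.mem_sup.mp hx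
      rw [← hyz, mul_add]
      rw [zz_mem_Q] at hy hz
      apply zz_PP.add_mem
      · have := zz_PP_mul _ _ hb hy
        rwa [mul_comm (zz_xs (-σ)), mul_assoc (_ * _) (zz_xs (-σ)), zz_xs_cancel'] at this
      · have := zz_PP_mul _ _ ha hz
        rwa [mul_comm (zz_xs σ), mul_assoc (_ * _) (zz_xs σ), zz_xs_cancel] at this
  induction L with
  | nil =>
    refine ⟨fun _ v => ⟨zz_Xi_one _ _, zz_Xi_one _ _, zz_Xi_one _ _, zz_Xi_one _ _⟩, fun h => ?_⟩
    simp at h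
  | cons p L ih =>
    obtain ⟨c, n⟩ := p
    rw [List.length_cons, Nat.even_add_one, not_not]
    set u := zz_hw A hgen r L with hu
    have hz : ∀ (s : ℂ) (v : V) (P : Submodule ℂ (LaurentSeries ℂ)), zz_xs s * zz_Xi A 0 v u ∈ P := by
      intro s v P
      rw [zz_Xi_zero, LinearMap.zero_apply, mul_zero]
      exact P.zero_mem
    have r0 := fun v => zz_rec_mem (r := r) hH c n u v F0 0 0 σ 0 0 (fun k x => by rw [h0]; simp)
    have rp := fun v => zz_rec_mem (r := r) hH c n u v Fp F0 0 σ (l c) 0 (fun k x => by rw [hp]; simp)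
    have rm := fun v => zz_rec_mem (r := r) hH c n u v Fm 0 F0 σ 0 (m c) (fun k x => by rw [hm]; simp)
    have rpm := fun v => zz_rec_mem (r := r) hH c n u v Fpm Fm Fp σ (l c) (m c) (hpm c)
    simp only [zz_hw]
    constructor
    · intro hodd v
      have hi := ih.2 hodd
      refine ⟨?_, ?_, ?_, ?_⟩
      · exact r0 v _ (hz _ _ _) (hz _ _ _) fun i => hkP _ _ _ _ _ _ (Submodule.mem_sup_left (hi _).1.1)
      · exact rp v _ (hi v).1.1 (hz _ _ _) fun i => hkP _ _ _ _ _ _ (Submodule.mem_sup_right (hi _).2.1)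
      · exact rm v _ (hz _ _ _) (hi v).1.2 fun i => hkP _ _ _ _ _ _ (Submodule.mem_sup_left (hi _).2.2.1)
      · exact rpm v _ (hi v).2.2.1 (hi v).2.1 fun i => hkP _ _ _ _ _ _ (hi _).2.2.2
    · intro heven v
      have hi := ih.1 heven
      have up : ∀ x ∈ zz_PP, zz_xs σ * x ∈ zz_Q (-σ) := fun x hx => by
        rw [zz_mem_Q, zz_xs_cancel']; exact hx
      have um : ∀ x ∈ zz_PP, zz_xs (-σ) * x ∈ zz_Q σ := fun x hx => by
        rw [zz_mem_Q, zz_xs_cancel]; exact hx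
      refine ⟨⟨?_, ?_⟩, ?_, ?_, ?_⟩
      · exact r0 v _ (hz _ _ _) (hz _ _ _) fun i => (hkQ _ _ _ _ _ _ (hi _).1).1
      · exact r0 v _ (hz _ _ _) (hz _ _ _) fun i => (hkQ _ _ _ _ _ _ (hi _).1).2
      · exact rp v _ (up _ (hi v).1) (hz _ _ _) fun i => (hkQ _ _ _ _ _ _ (hi _).2.1).2
      · exact rm v _ (hz _ _ _) (um _ (hi v).1) fun i => (hkQ _ _ _ _ _ _ (hi _).2.2.1).1
      · exact rpm v _ (Submodule.mem_sup_right (up _ (hi v).2.2.1)) (Submodule.mem_sup_left (um _ (hi v).2.1))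
          fun i => Submodule.mem_sup_left (hkQ _ _ _ _ _ _ (hi _).2.2.2).1

end

section
variable {V : Type} [AddCommGroup V] [Module ℂ V] {ℓ : ℕ} {A : VOA V} {hgen : Fin ℓ → V}

theorem zz_hh_zero (c : Fin ℓ) (p : ℤ) (x : V) : zz_hh A hgen 0 c p x = A.Y (hgen c) p x := by
  obtain ⟨N, hN⟩ := zz_trunc A (hgen c) x
  unfold zz_hh
  rw [zz_Op_eq c _ _ x (N + p.natAbs + 1) (fun j hj => hN j (by omega)), Finset.sum_range_succ', Finset.sum_eq_zero]
  · simp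
  · intro j _; rw [Ring.choose_zero_succ, zero_smul]

theorem zz_functional (hH : IsHeisenberg A hgen) {θ : V ≃ₗ[ℂ] V} (hθ : IsThetaAut A hgen θ) (r σ : ℂ)
    (hσ : (r = 0 ∧ (σ = 0 ∨ σ = 1 ∨ σ = -1)) ∨ (r = 1 / 2 ∧ (σ = 1 / 2 ∨ σ = - (1 / 2))))
    (a b : Fin ℓ) (hab : a ≠ b) : ∃ F : V →ₗ[ℂ] ℂ,
      (∀ (k : ℤ) (u v : V), u ∈ A.wt k → θ u = u → F (A.circAux k u v) = 0) ∧
      ∀ m : ℕ, F (SV A hgen a b 1 ((m : ℤ) + 1)) = Ring.choose (-σ - 1) m := by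
  have hr : r = 0 ∨ r = 1 / 2 := by
    rcases hσ with h | h
    · exact Or.inl h.1
    · exact Or.inr h.1
  obtain ⟨F0, h1, h0⟩ := zz_F0 hH hr
  let l : Fin ℓ → ℂ := fun c => if a = c then 1 else 0
  let m : Fin ℓ → ℂ := fun c => if b = c then 1 else 0
  have hE : ∀ (τ : ℂ) (d c : Fin ℓ) (n : ℕ) (x : V), zz_E A hgen τ d (zz_hh A hgen r c (-((n : ℤ) + 1)) x)
      = zz_hh A hgen r c (-((n : ℤ) + 1)) (zz_E A hgen τ d x) + ((if d = c then 1 else 0) * Ring.choose (τ + r) n) • x := by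
    intro τ d c n x
    rw [zz_E_comm hH]
    split_ifs <;> simp
  have e1 : σ - 1 + r = σ + r - 1 := by ring
  have e2 : -σ - 1 + r = -σ + r - 1 := by ring
  have hw := zz_words hH σ hσ F0 (F0 ∘ₗ zz_E A hgen (σ - 1) a) (F0 ∘ₗ zz_E A hgen (-σ - 1) b)
    (F0 ∘ₗ zz_E A hgen (σ - 1) a ∘ₗ zz_E A hgen (-σ - 1) b) l m h0
    (fun c n x => by
      simp only [LinearMap.comp_apply, hE, map_add, h0, map_smul, e1, l, smul_eq_mul, zero_add])
    (fun c n x => by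
      simp only [LinearMap.comp_apply, hE, map_add, h0, map_smul, e2, m, smul_eq_mul, zero_add])
    (fun c n x => by
      simp only [LinearMap.comp_apply, hE, map_add, h0, map_smul, e1, e2, l, m, smul_eq_mul, zero_add])
  refine ⟨F0 ∘ₗ zz_E A hgen (σ - 1) a ∘ₗ zz_E A hgen (-σ - 1) b, ?_, ?_⟩
  · intro k u v hu hfix
    set F := F0 ∘ₗ zz_E A hgen (σ - 1) a ∘ₗ zz_E A hgen (-σ - 1) b
    have hP : zz_Xi A F v u ∈ zz_PP := by
      have : Submodule.span ℂ {x | ∃ L : List (Fin ℓ × ℕ), Even L.length ∧ x = zz_hw A hgen r L} ≤ zz_PP.comap (zz_Xi A F v) := by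
        rw [Submodule.span_le]
        rintro _ ⟨L, hL, rfl⟩
        exact ((hw L).1 hL v).2.2.2
      exact this (zz_even hH hθ r u hfix)
    have h := hP 1 one_pos
    obtain ⟨N, hN⟩ := zz_trunc A u v
    rw [zz_Xi_eq A F v u k hu, zz_xs_mul_coeff _ _ _ (N + 2)] at h
    · rw [zz_circ A k u v (N + 2) (fun i hi => hN i (by push_cast at hi; omega)), map_sum, ← h]
      apply Finset.sum_congr rfl
      intro i _
      rw [map_smul, zz_R_coeff, smul_eq_mul, show -(1 - (i : ℤ)) - 1 = i - 2 by ring]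
    · intro j hj
      rw [zz_R_coeff, hN _ (by push_cast at hj; omega), map_zero]
  · intro n
    have e : SV A hgen a b 1 ((n : ℤ) + 1) = zz_hh A hgen 0 a (-(((0 : ℕ) : ℤ) + 1)) (zz_hh A hgen 0 b (-((n : ℤ) + 1)) A.one) := by
      rw [zz_hh_zero, zz_hh_zero]; rfl
    rw [e]
    simp only [LinearMap.comp_apply, zz_E_comm hH, zz_E_one, map_add, map_smul, map_zero, hab.symm, hab, if_true, if_false]
    simp [h1]

theorem zz_solve (c : Fin 5 → ℂ) (h : ∀ x : ℂ, (x = -1 ∨ x = -2 ∨ x = 0 ∨ x = -(3 / 2) ∨ x = -(1 / 2)) →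
    ∑ i : Fin 5, c i * Ring.choose x (i : ℕ) = 0) : c = 0 := by
  have hc : ∀ x : ℂ, Ring.choose x 1 = x ∧ Ring.choose x 2 = x * (x - 1) / 2 ∧ Ring.choose x 3 = x * (x - 1) * (x - 2) / 6
     ∧ Ring.choose x 4 = x * (x - 1) * (x - 2) * (x - 3) / 24 := by
    intro x
    have h1 := zz_choose_rec x 1
    have h2 := zz_choose_rec x 2
    have h3 := zz_choose_rec x 3
    simp only [Ring.choose_one_right, Nat.reduceAdd, Nat.cast_ofNat, Nat.cast_one] at h1 h2 h3
    have g1 : Ring.choose x 2 = x * (x - 1) / 2 := by linear_combination h1 / 2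
    rw [g1] at h2
    have g2 : Ring.choose x 3 = x * (x - 1) * (x - 2) / 6 := by linear_combination h2 / 3
    rw [g2] at h3
    exact ⟨Ring.choose_one_right x, g1, g2, by linear_combination h3 / 4⟩
  have h1 := h (-1) (by simp)
  have h2 := h (-2) (by simp)
  have h3 := h 0 (by simp)
  have h4 := h (-(3 / 2)) (by simp)
  have h5 := h (-(1 / 2)) (by simp)
  simp only [Fin.sum_univ_five, Fin.isValue, Fin.val_zero, Fin.val_one, Fin.val_two, show ((3 : Fin 5) : ℕ) = 3 from rfl,
    show ((4 : Fin 5) : ℕ) = 4 from rfl, Ring.choose_zero_right, (hc _).1, (hc _).2.1, (hc _).2.2.1, (hc _).2.2.2] at h1 h2 h3 h4 h5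
  norm_num at h1 h2 h3 h4 h5
  simp only [h3, zero_add] at h1 h2 h4 h5
  have g1 : c 4 = 0 := by linear_combination (96) * h1 + (16) * h2 + (-64) * h4 + (-64) * h5
  have g2 : c 3 = 0 := by linear_combination (240) * h1 + (36) * h2 + (-152) * h4 + (-168) * h5
  have g3 : c 2 = 0 := by linear_combination (190) * h1 + (25) * h2 + (-112) * h4 + (-144) * h5
  have g4 : c 1 = 0 := by linear_combination (45) * h1 + (5) * h2 + (-24) * h4 + (-40) * h5
  ext i
  fin_cases i <;> assumption

end


/-- Proposition 4.3.5. For distinct `a,b`, the subspace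
`𝒮_{ab}` of `A(𝓗⁺)` spanned by all `S_{ab}(m,n) + O(𝓗⁺)`, `m,n ≥ 1`, is exactly
5-dimensional, with basis `{S_{ab}(1,m) + O(𝓗⁺) | 1 ≤ m ≤ 5}`: every
`S_{ab}(m,n)` is congruent mod `O(𝓗⁺)` to a combination of the `S_{ab}(1,m)`,
`1 ≤ m ≤ 5`, and the latter are linearly independent mod `O(𝓗⁺)`. -/
theorem statement13 (ℓ : ℕ) {V W : Type} [AddCommGroup V] [Module ℂ V]
    [AddCommGroup W] [Module ℂ W] (S : HeisenbergPlusSetting ℓ V W)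
    (s : Fin ℓ → Fin ℓ → ℤ → ℤ → W)
    (hs : ∀ a b m n, S.ι (s a b m n) = SV S.A S.hgen a b m n)
    (a b : Fin ℓ) (hab : a ≠ b) :
    (∀ m n : ℤ, 1 ≤ m → 1 ≤ n → ∃ c : Fin 5 → ℂ,
      s a b m n - ∑ i : Fin 5, c i • s a b 1 ((i : ℕ) + 1 : ℤ) ∈ S.B.Osub) ∧
    (∀ c : Fin 5 → ℂ,
      (∑ i : Fin 5, c i • s a b 1 ((i : ℕ) + 1 : ℤ)) ∈ S.B.Osub → c = 0) := by
  constructor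
  · intro m n hm hn
    obtain ⟨c, hc⟩ := zz_span S.heis S.thetaAut (S.B.Osub.map S.ι) (zz_O1 S) (zz_O2 S) a b hab m n hm hn
    refine ⟨c, ?_⟩
    obtain ⟨w, hw, hw'⟩ := Submodule.mem_map.mp hc
    have : w = s a b m n - ∑ i : Fin 5, c i • s a b 1 ((i : ℕ) + 1 : ℤ) := by
      apply S.fixedSub.inj
      rw [hw', map_sub, map_sum, hs]
      simp only [map_smul, hs]
    rwa [← this]
  · intro c hc
    have key : ∀ r σ : ℂ, ((r = 0 ∧ (σ = 0 ∨ σ = 1 ∨ σ = -1)) ∨ (r = 1 / 2 ∧ (σ = 1 / 2 ∨ σ = - (1 / 2)))) →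
        ∑ i : Fin 5, c i * Ring.choose (-σ - 1) (i : ℕ) = 0 := by
      intro r σ hσ
      obtain ⟨F, hF, hF'⟩ := zz_functional S.heis S.thetaAut r σ hσ a b hab
      have hk : S.B.Osub ≤ LinearMap.ker (F ∘ₗ S.ι) := by
        unfold VOA.Osub
        rw [Submodule.span_le]
        rintro _ ⟨k, u, v, hu, rfl⟩
        rw [SetLike.mem_coe, LinearMap.mem_ker, LinearMap.comp_apply, zz_iota_circ]
        exact hF k _ _ ((S.fixedSub.map_wt k u).mp hu) (zz_iota_fix S u)
      have := hk hc
      rw [LinearMap.mem_ker, LinearMap.comp_apply, map_sum, map_sum] at this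
      simpa only [map_smul, hs, hF', smul_eq_mul] using this
    apply zz_solve
    intro x hx
    rcases hx with rfl | rfl | rfl | rfl | rfl
    · convert key 0 0 (by simp) using 4; norm_num
    · convert key 0 1 (by simp) using 4; norm_num
    · convert key 0 (-1) (by simp) using 4; norm_num
    · convert key (1 / 2) (1 / 2) (by simp) using 4; norm_num
    · convert key (1 / 2) (-(1 / 2)) (by simp) using 4; norm_num
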